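/- arXiv:1810.08679 — 2 statements merged into one kernel-verified Lean document; each statement's English description precedes it below -/
import Mathlib

section
/- Assume the generalized Hardy–Littlewood conjecture (GHL). Then |A_{≤x}| is asymptotically equal to (𝔖_A/2)·x/(log x)³, i.e. |A_{≤x}|·(log x)³/x → 𝔖_A/2 as x → ∞. -/
/-- `A` is the set of primes `p` with `p ≡ 2 (mod 3)` such that there exist
`α, β, γ ≥ 1` and primes `q, r`, both coprime to `6`, with
`p + 1 = 2^α * 3^β * q` and `p - 1 = 2^γ * r`. -/
def A : Set ℕ :=
  {p | p.Prime ∧ p % 3 = 2 ∧ ∃ α β γ q r : ℕ,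
    1 ≤ α ∧ 1 ≤ β ∧ 1 ≤ γ ∧
    q.Prime ∧ r.Prime ∧ Nat.Coprime q 6 ∧ Nat.Coprime r 6 ∧
    p + 1 = 2 ^ α * 3 ^ β * q ∧ p - 1 = 2 ^ γ * r}

/-- The singular series constant `𝔖_A = 9 * ∏_{p ≥ 5 prime} (1 - 3/p) (1 - 1/p)⁻³`. -/
noncomputable def SA : ℝ :=
  9 * ∏' p : {p : ℕ // p.Prime ∧ 5 ≤ p},
    (1 - 3 / (p.1 : ℝ)) * ((1 - 1 / (p.1 : ℝ))⁻¹) ^ 3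

/-- `ρ(ℓ)`: the number of residues `n` modulo `ℓ` with `∏ i, (a i * n + b i) ≡ 0 (mod ℓ)`. -/
noncomputable def rho (R : ℕ) (a b : Fin R → ℤ) (ℓ : ℕ) : ℕ :=
  Set.ncard {n : ZMod ℓ | ∏ i, ((a i : ZMod ℓ) * n + (b i : ZMod ℓ)) = 0}

/-- The factor at the prime `ℓ` of the Hardy–Littlewood singular series. -/
noncomputable def singFactor (R : ℕ) (a b : Fin R → ℤ) (ℓ : {ℓ : ℕ // ℓ.Prime}) : ℝ :=
  (1 - (rho R a b ℓ.1 : ℝ) / (ℓ.1 : ℝ)) * ((1 - 1 / (ℓ.1 : ℝ))⁻¹) ^ R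

/-- The Hardy–Littlewood singular series `𝔖` attached to the linear forms `aᵢ n + bᵢ`. -/
noncomputable def singSeries (R : ℕ) (a b : Fin R → ℤ) : ℝ :=
  ∏' ℓ : {ℓ : ℕ // ℓ.Prime}, singFactor R a b ℓ

/-- The number of `n ≤ x` such that `aᵢ n + bᵢ` is prime for all `i`. -/
noncomputable def primeTupleCount (R : ℕ) (a b : Fin R → ℤ) (x : ℝ) : ℕ :=
  Set.ncard {n : ℕ | (n : ℝ) ≤ x ∧
    ∀ i, ∃ pr : ℕ, pr.Prime ∧ a i * (n : ℤ) + b i = (pr : ℤ)}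

/-- The generalized Hardy–Littlewood conjecture with uniform error term. -/
def GHL : Prop :=
  ∀ (R : ℕ) (C ε : ℝ), 0 < C → 0 < ε → ∃ x₀ : ℝ, ∀ x : ℝ, x₀ ≤ x →
    ∀ a b : Fin R → ℤ, (∀ i, 0 < a i) → (∀ i, IsCoprime (a i) (b i)) →
      (∀ i, |(a i : ℝ)| ≤ Real.log x ^ C ∧ |(b i : ℝ)| ≤ Real.log x ^ C) →
      Multipliable (singFactor R a b) →
      |(primeTupleCount R a b x : ℝ) - singSeries R a b * x / (Real.log x) ^ R| ≤
        ε * (singSeries R a b + 1) * x / (Real.log x) ^ R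

/-- Compatible linear forms `M n + c`, `aq n + bq`, `ar n + br` with `M = 2^(i+2) * 3^(j+1)`,
parametrizing the integers `p`, `(p + 1) / (2^α * 3^(j+1))` and `(p - 1) / 2^γ`. -/
structure PieceForms (i j α γ M : ℕ) where
  aq : ℕ
  bq : ℕ
  ar : ℕ
  br : ℕ
  c : ℕ
  exponents : (α = i + 2 ∧ γ = 1) ∨ (α = 1 ∧ γ = i + 2)
  modulus_eq : M = 2 ^ (i + 2) * 3 ^ (j + 1)
  modulus_q : 2 ^ α * 3 ^ (j + 1) * aq = M
  modulus_r : 2 ^ γ * ar = M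
  const_q : 2 ^ α * 3 ^ (j + 1) * bq = c + 1
  const_r : 2 ^ γ * br + 1 = c
  const_lt : c < M

theorem PieceForms.nonempty {i j α γ : ℕ}
    (h : (α = i + 2 ∧ γ = 1) ∨ (α = 1 ∧ γ = i + 2)) :
    Nonempty (PieceForms i j α γ (2 ^ (i + 2) * 3 ^ (j + 1))) := by
  rcases h with ⟨rfl, rfl⟩ | ⟨rfl, rfl⟩
  · have h1 : 1 ≤ 2 ^ (i + 1) * 3 ^ (j + 1) := Nat.one_le_iff_ne_zero.2 (by positivity)
    have h2 : 2 ^ (i + 2) * 3 ^ (j + 1) = 2 * (2 ^ (i + 1) * 3 ^ (j + 1)) := by ring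
    refine ⟨⟨1, 1, 2 ^ (i + 1) * 3 ^ (j + 1), 2 ^ (i + 1) * 3 ^ (j + 1) - 1,
      2 ^ (i + 2) * 3 ^ (j + 1) - 1, Or.inl ⟨rfl, rfl⟩, rfl, by ring, by ring, ?_, ?_, ?_⟩⟩ <;> omega
  · have hco : Nat.Coprime (2 ^ (i + 2)) (3 ^ (j + 1)) :=
      Nat.Coprime.pow _ _ (by norm_num)
    set k := Nat.chineseRemainder hco 1 (3 ^ (j + 1) - 1) with hk
    have hlt := Nat.chineseRemainder_lt_mul hco 1 (3 ^ (j + 1) - 1) (by positivity) (by positivity)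
    obtain ⟨h1, h2⟩ := k.2
    have h3 : 1 ≤ 3 ^ (j + 1) := Nat.one_le_iff_ne_zero.2 (by positivity)
    have hk1 : 1 ≤ (k : ℕ) := by
      by_contra h0
      have h0' : (k : ℕ) = 0 := by omega
      rw [h0'] at h1
      have := (Nat.modEq_iff_dvd' (Nat.zero_le 1)).1 h1
      have h4 : 2 ∣ 2 ^ (i + 2) := dvd_pow_self _ (by omega)
      have := h4.trans this
      omega
    have hv : 2 ^ (i + 2) ∣ (k : ℕ) - 1 := (Nat.modEq_iff_dvd' hk1).1 h1.symm
    have hu3 : 3 ^ (j + 1) ∣ (k : ℕ) + 1 := by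
      have := h2.add_right 1
      rw [Nat.sub_add_cancel h3] at this
      exact (Nat.modEq_zero_iff_dvd.1 (this.trans (by simp [Nat.ModEq])))
    have hu2 : 2 ∣ (k : ℕ) + 1 := by
      have h4 : 2 ∣ 2 ^ (i + 2) := dvd_pow_self _ (by omega)
      have := h4.trans hv
      omega
    have hu : 2 ^ 1 * 3 ^ (j + 1) ∣ (k : ℕ) + 1 :=
      Nat.Coprime.mul_dvd_of_dvd_of_dvd (Nat.Coprime.pow _ _ (by norm_num)) (by simpa using hu2) hu3
    obtain ⟨br, hbr⟩ := hv
    obtain ⟨bq, hbq⟩ := hu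
    refine ⟨⟨2 ^ (i + 1), bq, 3 ^ (j + 1), br, k, Or.inr ⟨rfl, rfl⟩, rfl, by ring, by ring,
      hbq.symm, by omega, hlt⟩⟩

namespace PieceForms

variable {i j α γ M : ℕ} (F : PieceForms i j α γ M)

theorem parity : (F.aq % 2 = 1 ∧ F.ar % 2 = 0 ∧ F.br % 2 = 1) ∨
    (F.aq % 2 = 0 ∧ F.bq % 2 = 1 ∧ F.ar % 2 = 1) := by
  obtain ⟨aq, bq, ar, br, c, h, hM, hq, hr, hcq, hcr, hlt⟩ := F
  simp only
  rcases h with ⟨rfl, rfl⟩ | ⟨rfl, rfl⟩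
  · left
    have h1 : aq = 1 := by
      rw [hM] at hq
      exact Nat.eq_of_mul_eq_mul_left (by positivity) (hq.trans (mul_one _).symm)
    have h2 : ar = 2 * (2 ^ i * 3 ^ (j + 1)) := by
      rw [hM] at hr
      refine Nat.eq_of_mul_eq_mul_left (by norm_num : 0 < 2 ^ 1) (hr.trans (by ring))
    have h3 : 2 ^ (i + 2) * 3 ^ (j + 1) * bq = 4 * (2 ^ i * 3 ^ (j + 1) * bq) := by ring
    omega
  · right
    have h1 : aq = 2 * 2 ^ i := by
      rw [hM] at hq
      exact Nat.eq_of_mul_eq_mul_left (by positivity : 0 < 2 ^ 1 * 3 ^ (j + 1))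
        (hq.trans (by ring))
    have h2 : ar = 3 ^ (j + 1) := by
      rw [hM] at hr
      exact Nat.eq_of_mul_eq_mul_left (by positivity) hr
    have h3 : (3 ^ (j + 1)) % 2 = 1 := by
      rw [Nat.pow_mod]; simp
    have h4 : 2 ^ (i + 2) * br = 4 * (2 ^ i * br) := by ring
    have h5 : 3 ^ (j + 1) * bq = 2 * (2 ^ i * br) + 1 := by
      have : 2 ^ 1 * 3 ^ (j + 1) * bq = 2 * (3 ^ (j + 1) * bq) := by ring
      omega
    have h6 : bq % 2 = 1 := by
      by_contra h7
      have h8 : 2 ∣ bq := by omega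
      have := h8.mul_left (3 ^ (j + 1))
      omega
    omega

theorem c_odd : F.c % 2 = 1 := by
  obtain ⟨aq, bq, ar, br, c, h, hM, hq, hr, hcq, hcr, hlt⟩ := F
  simp only
  have h1 : 2 ∣ 2 ^ γ * br := (dvd_pow_self 2 (by omega)).mul_right _
  omega

theorem c_mod_three : F.c % 3 = 2 := by
  obtain ⟨aq, bq, ar, br, c, h, hM, hq, hr, hcq, hcr, hlt⟩ := F
  simp only
  have h1 : 3 ∣ 2 ^ α * 3 ^ (j + 1) * bq :=
    ((dvd_pow_self 3 (by omega)).mul_left _).mul_right _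
  omega

theorem three_dvd_ar : 3 ∣ F.ar := by
  have h1 : 3 ∣ 2 ^ γ * F.ar := by
    rw [F.modulus_r, F.modulus_eq]
    exact (dvd_pow_self 3 (by omega)).mul_left _
  exact (Nat.Coprime.pow_right γ (by norm_num : Nat.Coprime 3 2)).dvd_of_dvd_mul_left h1

theorem not_three_dvd_br : ¬ 3 ∣ F.br := fun h => by
  have h1 := F.c_mod_three
  have h2 := h.mul_left (2 ^ γ)
  have h3 := F.const_r
  omega

theorem aq_dvd : F.aq ∣ 2 ^ (i + 2) := by
  have h : 3 ^ (j + 1) * (2 ^ α * F.aq) = 3 ^ (j + 1) * 2 ^ (i + 2) := by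
    linarith [F.modulus_q.trans F.modulus_eq]
  exact (Nat.eq_of_mul_eq_mul_left (by positivity) h) ▸ dvd_mul_left _ _

theorem not_three_dvd_aq : ¬ 3 ∣ F.aq := fun h => by
  have := Nat.prime_three.dvd_of_dvd_pow (h.trans F.aq_dvd)
  omega

theorem ar_dvd : F.ar ∣ 2 ^ (i + 2) * 3 ^ (j + 1) := by
  rw [← F.modulus_r.trans F.modulus_eq]
  exact dvd_mul_left _ _

theorem modulus_pos (F : PieceForms i j α γ M) : 0 < M := by
  rw [F.modulus_eq]
  positivity

theorem coprime_modulus : Nat.Coprime M F.c := by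
  suffices h : Nat.Coprime (2 ^ (i + 2) * 3 ^ (j + 1)) F.c from F.modulus_eq.symm ▸ h
  refine Nat.Coprime.mul_left (Nat.Coprime.pow_left _ ?_) (Nat.Coprime.pow_left _ ?_)
  · rw [Nat.Prime.coprime_iff_not_dvd Nat.prime_two]
    have := F.c_odd
    omega
  · rw [Nat.Prime.coprime_iff_not_dvd Nat.prime_three]
    have := F.c_mod_three
    omega

theorem coprime_q : Nat.Coprime F.aq F.bq := by
  refine Nat.coprime_of_dvd fun k hk h1 h2 => ?_
  have h3 : k = 2 := (Nat.prime_dvd_prime_iff_eq hk Nat.prime_two).1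
    (hk.dvd_of_dvd_pow (h1.trans F.aq_dvd))
  subst h3
  have := F.parity
  omega

theorem coprime_r : Nat.Coprime F.ar F.br := by
  refine Nat.coprime_of_dvd fun k hk h1 h2 => ?_
  rcases (hk.dvd_mul).1 (h1.trans F.ar_dvd) with h | h
  · have h3 : k = 2 := (Nat.prime_dvd_prime_iff_eq hk Nat.prime_two).1 (hk.dvd_of_dvd_pow h)
    subst h3
    have := F.parity
    omega
  · have h3 : k = 3 := (Nat.prime_dvd_prime_iff_eq hk Nat.prime_three).1 (hk.dvd_of_dvd_pow h)
    subst h3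
    exact F.not_three_dvd_br h2

/-- The leading coefficients of the three forms. -/
def lead : Fin 3 → ℤ := ![(M : ℤ), F.aq, F.ar]

/-- The constant coefficients of the three forms. -/
def const : Fin 3 → ℤ := ![(F.c : ℤ), F.bq, F.br]

theorem aq_pos : 0 < F.aq := Nat.pos_of_ne_zero fun h => by
  have h1 := F.modulus_q
  have h2 := F.modulus_pos
  simp [h] at h1
  omega

theorem ar_pos : 0 < F.ar := Nat.pos_of_ne_zero fun h => by
  have h1 := F.modulus_r
  have h2 := F.modulus_pos
  simp [h] at h1
  omega

theorem aq_le : F.aq ≤ M := by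
  conv_rhs => rw [← F.modulus_q]
  exact Nat.le_mul_of_pos_left _ (by positivity)

theorem ar_le : F.ar ≤ M := by
  conv_rhs => rw [← F.modulus_r]
  exact Nat.le_mul_of_pos_left _ (by positivity)

theorem bq_le : F.bq ≤ M := by
  have h1 : F.bq ≤ 2 ^ α * 3 ^ (j + 1) * F.bq := Nat.le_mul_of_pos_left _ (by positivity)
  have h2 := F.const_q
  have h3 := F.const_lt
  omega

theorem br_le : F.br ≤ M := by
  have h1 : F.br ≤ 2 ^ γ * F.br := Nat.le_mul_of_pos_left _ (by positivity)
  have h2 := F.const_r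
  have h3 := F.const_lt
  omega

theorem lead_pos (k : Fin 3) : 0 < F.lead k := by
  have h1 := F.modulus_pos
  have h2 := F.aq_pos
  have h3 := F.ar_pos
  fin_cases k <;> simpa [lead]

theorem isCoprime_lead_const (k : Fin 3) : IsCoprime (F.lead k) (F.const k) := by
  have h1 := F.coprime_modulus
  have h2 := F.coprime_q
  have h3 := F.coprime_r
  fin_cases k <;> simpa [lead, const, Nat.isCoprime_iff_coprime]

theorem abs_lead_le (k : Fin 3) : |(F.lead k : ℝ)| ≤ M := by
  have h2 := F.aq_le
  have h3 := F.ar_le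
  fin_cases k <;> simp [lead, *]

theorem abs_const_le (k : Fin 3) : |(F.const k : ℝ)| ≤ M := by
  have h1 := F.const_lt.le
  have h2 := F.bq_le
  have h3 := F.br_le
  fin_cases k <;> simpa [const]

theorem rho_eq_ncard (l : ℕ) : rho 3 F.lead F.const l = Set.ncard {n : ZMod l |
    ((M : ZMod l) * n + F.c) * ((F.aq : ZMod l) * n + F.bq) * ((F.ar : ZMod l) * n + F.br) = 0} := by
  simp [rho, lead, const, Fin.prod_univ_three]

theorem rho_two : rho 3 F.lead F.const 2 = 1 := by
  rw [rho_eq_ncard, Set.ncard_eq_one]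
  have e (m : ℕ) : ((m : ℕ) : ZMod 2) = ((m % 2 : ℕ) : ZMod 2) := (ZMod.natCast_mod m 2).symm
  have hM : M % 2 = 0 := by
    rw [F.modulus_eq, ← Nat.dvd_iff_mod_eq_zero]
    exact (dvd_pow_self 2 (by omega)).mul_right _
  have hc := F.c_odd
  rw [e M, e F.c, e F.aq, e F.bq, e F.ar, e F.br, hM, hc]
  rcases F.parity with ⟨h1, h2, h3⟩ | ⟨h1, h2, h3⟩ <;> rw [h1, h2, h3]
  · rcases Nat.mod_two_eq_zero_or_one F.bq with h | h <;> rw [h]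
    · exact ⟨0, by ext n; fin_cases n <;> simp⟩
    · exact ⟨1, by ext n; simp; revert n; decide⟩
  · rcases Nat.mod_two_eq_zero_or_one F.br with h | h <;> rw [h]
    · exact ⟨0, by ext n; fin_cases n <;> simp⟩
    · exact ⟨1, by ext n; simp; revert n; decide⟩

theorem rho_three : rho 3 F.lead F.const 3 = 1 := by
  have : Fact (Nat.Prime 3) := ⟨Nat.prime_three⟩
  rw [rho_eq_ncard, Set.ncard_eq_one]
  have hM : (M : ZMod 3) = 0 := by
    rw [ZMod.natCast_eq_zero_iff, F.modulus_eq]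
    exact (dvd_pow_self 3 (by omega)).mul_left _
  have har : (F.ar : ZMod 3) = 0 := by
    rw [ZMod.natCast_eq_zero_iff]
    exact F.three_dvd_ar
  have hbr : (F.br : ZMod 3) ≠ 0 := by
    rw [Ne, ZMod.natCast_eq_zero_iff]
    exact F.not_three_dvd_br
  have haq : (F.aq : ZMod 3) ≠ 0 := by
    rw [Ne, ZMod.natCast_eq_zero_iff]
    exact F.not_three_dvd_aq
  have hc : (F.c : ZMod 3) ≠ 0 := by
    rw [Ne, ZMod.natCast_eq_zero_iff]
    have := F.c_mod_three
    omega
  refine ⟨-F.bq / F.aq, ?_⟩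
  ext n
  simp only [hM, har, zero_mul, zero_add, Set.mem_ofPred_eq, Set.mem_singleton_iff, mul_eq_zero, hc,
    hbr, false_or, or_false, eq_div_iff haq]
  rw [add_eq_zero_iff_eq_neg, mul_comm]

theorem rho_of_five_le {l : ℕ} (hl : l.Prime) (h5 : 5 ≤ l) : rho 3 F.lead F.const l = 3 := by
  have : Fact l.Prime := ⟨hl⟩
  have h2 : (2 : ZMod l) ≠ 0 := by
    have : ((2 : ℕ) : ZMod l) ≠ 0 := by
      rw [Ne, ZMod.natCast_eq_zero_iff]
      exact fun h => absurd (Nat.le_of_dvd (by norm_num) h) (by omega)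
    exact_mod_cast this
  have h3 : (3 : ZMod l) ≠ 0 := by
    have : ((3 : ℕ) : ZMod l) ≠ 0 := by
      rw [Ne, ZMod.natCast_eq_zero_iff]
      exact fun h => absurd (Nat.le_of_dvd (by norm_num) h) (by omega)
    exact_mod_cast this
  have hM : (M : ZMod l) ≠ 0 := by
    rw [F.modulus_eq]
    push_cast
    exact mul_ne_zero (pow_ne_zero _ h2) (pow_ne_zero _ h3)
  have e1 : (2 ^ α * 3 ^ (j + 1) : ZMod l) * F.aq = M := by
    exact_mod_cast congrArg (Nat.cast (R := ZMod l)) F.modulus_q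
  have e2 : (2 ^ γ : ZMod l) * F.ar = M := by
    exact_mod_cast congrArg (Nat.cast (R := ZMod l)) F.modulus_r
  have e3 : (2 ^ α * 3 ^ (j + 1) : ZMod l) * F.bq = F.c + 1 := by
    exact_mod_cast congrArg (Nat.cast (R := ZMod l)) F.const_q
  have e4 : (2 ^ γ : ZMod l) * F.br + 1 = F.c := by
    exact_mod_cast congrArg (Nat.cast (R := ZMod l)) F.const_r
  have hu : (2 ^ α * 3 ^ (j + 1) : ZMod l) ≠ 0 := mul_ne_zero (pow_ne_zero _ h2) (pow_ne_zero _ h3)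
  have hv : (2 ^ γ : ZMod l) ≠ 0 := pow_ne_zero _ h2
  rw [rho_eq_ncard, Set.ncard_eq_three]
  refine ⟨-F.c / M, (-1 - F.c) / M, (1 - F.c) / M, ?_, ?_, ?_, ?_⟩
  · intro h
    rw [div_left_inj' hM] at h
    exact one_ne_zero (by linear_combination h : (1 : ZMod l) = 0)
  · intro h
    rw [div_left_inj' hM] at h
    exact one_ne_zero (by linear_combination -h : (1 : ZMod l) = 0)
  · intro h
    rw [div_left_inj' hM] at h
    exact h2 (by linear_combination -h)
  · ext n
    simp only [Set.mem_ofPred_eq, mul_eq_zero, Set.mem_insert_iff, Set.mem_singleton_iff,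
      eq_div_iff hM, or_assoc]
    refine or_congr ?_ (or_congr ?_ ?_)
    · constructor <;> intro h <;> linear_combination h
    · rw [← mul_right_inj' hu, mul_zero]
      constructor <;> intro h
      · linear_combination h - n * e1 - e3
      · linear_combination h + n * e1 + e3
    · rw [← mul_right_inj' hv, mul_zero]
      constructor <;> intro h
      · linear_combination h - n * e2 - e4
      · linear_combination h + n * e2 + e4

end PieceForms

/-- The local factor at `l ≥ 5`, where three residue classes are excluded. -/
noncomputable def eulerFactor (l : ℕ) : ℝ :=
  (1 - 3 / (l : ℝ)) * ((1 - 1 / (l : ℝ))⁻¹) ^ 3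

theorem abs_eulerFactor_sub_one_le {l : ℕ} (hl : 2 ≤ l) :
    |eulerFactor l - 1| ≤ 24 * (1 / (l : ℝ) ^ 2) := by
  have hl' : (2 : ℝ) ≤ l := by exact_mod_cast hl
  have h0 : (0 : ℝ) < l := by linarith
  obtain ⟨u, hu⟩ : ∃ u : ℝ, u = 1 / l := ⟨_, rfl⟩
  have hu0 : 0 < u := by rw [hu]; positivity
  have hu1 : u ≤ 1 / 2 := by
    rw [hu]
    exact one_div_le_one_div_of_le (by norm_num) hl'
  have h1 : (1 / 2 : ℝ) ≤ 1 - u := by linarith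
  have h3 : eulerFactor l - 1 = -(u ^ 2 * (3 - u)) / (1 - u) ^ 3 := by
    have h2 : 1 - u ≠ 0 := by linarith
    have h4 : (3 : ℝ) / l = 3 * u := by rw [hu]; ring
    rw [eulerFactor, h4, ← hu]
    field_simp
    ring
  have h5 : (1 / 8 : ℝ) ≤ (1 - u) ^ 3 := by
    calc (1 / 8 : ℝ) = (1 / 2) ^ 3 := by norm_num
      _ ≤ _ := by gcongr
  have h6 : 1 / (l : ℝ) ^ 2 = u ^ 2 := by rw [hu]; ring
  rw [h3, h6, abs_div, abs_neg, abs_of_nonneg (by positivity : 0 ≤ (1 - u) ^ 3),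
    abs_of_nonneg (mul_nonneg (by positivity) (by linarith)), div_le_iff₀ (by positivity)]
  nlinarith [mul_le_mul_of_nonneg_left h5 (sq_nonneg u), pow_pos hu0 3]

/-- The correction of the local factors at `2` and `3`. -/
noncomputable def smallFactor (l : ℕ) : ℝ :=
  if l = 2 then 4 else if l = 3 then 9 / 4 else 1

theorem mulIndicator_five_le_eq (l : ℕ) :
    Set.mulIndicator {l : ℕ | l.Prime ∧ 5 ≤ l} eulerFactor l =
      1 + Set.indicator {l : ℕ | l.Prime ∧ 5 ≤ l} (fun l => eulerFactor l - 1) l := by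
  by_cases h : l ∈ {l : ℕ | l.Prime ∧ 5 ≤ l} <;> simp [h]

theorem multipliable_mulIndicator_eulerFactor :
    Multipliable (Set.mulIndicator {l : ℕ | l.Prime ∧ 5 ≤ l} eulerFactor) := by
  rw [funext mulIndicator_five_le_eq]
  refine Real.multipliable_one_add_of_summable ?_
  refine Summable.of_norm_bounded
    ((Real.summable_one_div_nat_pow.2 one_lt_two).mul_left 24) fun l => ?_
  by_cases h : l ∈ {l : ℕ | l.Prime ∧ 5 ≤ l}
  · rw [Set.indicator_of_mem h, Real.norm_eq_abs]
    exact abs_eulerFactor_sub_one_le (h.1.two_le)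
  · rw [Set.indicator_of_notMem h, norm_zero]
    positivity

theorem multipliable_smallFactor : Multipliable smallFactor :=
  multipliable_of_ne_finset_one (s := {2, 3}) fun b hb => by
    simp only [Finset.mem_insert, Finset.mem_singleton, not_or] at hb
    simp [smallFactor, hb.1, hb.2]

theorem tprod_smallFactor : ∏' l, smallFactor l = 9 := by
  rw [tprod_eq_prod (s := {2, 3})]
  · rw [Finset.prod_pair (by norm_num)]
    norm_num [smallFactor]
  · intro b hb
    simp only [Finset.mem_insert, Finset.mem_singleton, not_or] at hb
    simp [smallFactor, hb.1, hb.2]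

/-- The local factors of the singular series, extended by `1` to all natural numbers. -/
noncomputable def fullFactor (l : ℕ) : ℝ :=
  smallFactor l * Set.mulIndicator {l : ℕ | l.Prime ∧ 5 ≤ l} eulerFactor l

theorem multipliable_fullFactor : Multipliable fullFactor :=
  multipliable_smallFactor.mul multipliable_mulIndicator_eulerFactor

theorem tprod_fullFactor : ∏' l, fullFactor l = SA := by
  unfold fullFactor
  rw [multipliable_smallFactor.tprod_mul multipliable_mulIndicator_eulerFactor, tprod_smallFactor,
    ← tprod_subtype]
  rfl

theorem mulIndicator_prime_fullFactor :
    Set.mulIndicator {l : ℕ | l.Prime} fullFactor = fullFactor := by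
  rw [Set.mulIndicator_eq_self]
  intro l hl
  by_contra h
  refine hl ?_
  have h2 : l ≠ 2 := fun e => h (e ▸ Nat.prime_two)
  have h3 : l ≠ 3 := fun e => h (e ▸ Nat.prime_three)
  have h5 : l ∉ {l : ℕ | l.Prime ∧ 5 ≤ l} := fun e => h e.1
  simp [fullFactor, smallFactor, h2, h3, Set.mulIndicator_of_notMem h5]

theorem PieceForms.singFactor_eq {i j α γ M : ℕ} (F : PieceForms i j α γ M) :
    singFactor 3 F.lead F.const = fullFactor ∘ Subtype.val := by
  ext ⟨l, hl⟩
  by_cases h2 : l = 2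
  · subst h2
    norm_num [singFactor, F.rho_two, fullFactor, smallFactor]
  by_cases h3 : l = 3
  · subst h3
    norm_num [singFactor, F.rho_three, fullFactor, smallFactor]
  have h5 : 5 ≤ l := by
    have := hl.two_le
    by_contra h
    have h4 : l = 4 := by omega
    subst h4
    norm_num at hl
  have hmem : l ∈ {l : ℕ | l.Prime ∧ 5 ≤ l} := ⟨hl, h5⟩
  simp [singFactor, F.rho_of_five_le hl h5, fullFactor, smallFactor, h2, h3,
    Set.mulIndicator_of_mem hmem, eulerFactor]

theorem PieceForms.multipliable_singFactor {i j α γ M : ℕ} (F : PieceForms i j α γ M) :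
    Multipliable (singFactor 3 F.lead F.const) := by
  rw [F.singFactor_eq]
  refine (multipliable_subtype_iff_mulIndicator (s := {l : ℕ | l.Prime})).2 ?_
  rw [mulIndicator_prime_fullFactor]
  exact multipliable_fullFactor

theorem PieceForms.singSeries_eq {i j α γ M : ℕ} (F : PieceForms i j α γ M) :
    singSeries 3 F.lead F.const = SA := by
  rw [singSeries, F.singFactor_eq, ← tprod_fullFactor, ← mulIndicator_prime_fullFactor,
    ← tprod_subtype, mulIndicator_prime_fullFactor]
  rfl

/-- The primes `p` with `p + 1 = 2^α * 3^β * q` and `p - 1 = 2^γ * r` for primes `q`, `r`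
coprime to `6`. -/
def piece (α β γ : ℕ) : Set ℕ :=
  {p | p.Prime ∧ ∃ q r : ℕ, q.Prime ∧ r.Prime ∧ Nat.Coprime q 6 ∧ Nat.Coprime r 6 ∧
    p + 1 = 2 ^ α * 3 ^ β * q ∧ p - 1 = 2 ^ γ * r}

theorem finite_inter_le (S : Set ℕ) (x : ℝ) : (S ∩ {n : ℕ | (n : ℝ) ≤ x}).Finite :=
  (Set.finite_Iic ⌊x⌋₊).subset fun _ hn => Nat.le_floor hn.2

theorem finite_primeTuples (R : ℕ) (a b : Fin R → ℤ) (x : ℝ) :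
    {n : ℕ | (n : ℝ) ≤ x ∧
      ∀ i, ∃ pr : ℕ, pr.Prime ∧ a i * (n : ℤ) + b i = (pr : ℤ)}.Finite :=
  (Set.finite_Iic ⌊x⌋₊).subset fun _ hn => Nat.le_floor hn.1

theorem primeTupleCount_mono {R : ℕ} (a b : Fin R → ℤ) {x y : ℝ} (h : x ≤ y) :
    primeTupleCount R a b x ≤ primeTupleCount R a b y :=
  Set.ncard_le_ncard (fun _ hn => ⟨hn.1.trans h, hn.2⟩) (finite_primeTuples R a b y)

theorem primeTupleCount_le {R : ℕ} (a b : Fin R → ℤ) {x : ℝ} (hx : 0 ≤ x) :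
    (primeTupleCount R a b x : ℝ) ≤ x + 1 := by
  have h : primeTupleCount R a b x ≤ (Set.Iic ⌊x⌋₊).ncard :=
    Set.ncard_le_ncard (fun _ hn => Nat.le_floor hn.1) (Set.finite_Iic _)
  have h2 : (Set.Iic ⌊x⌋₊).ncard = ⌊x⌋₊ + 1 := by
    rw [← Finset.coe_Iic, Set.ncard_coe_finset, Nat.card_Iic]
  rw [h2] at h
  calc (primeTupleCount R a b x : ℝ) ≤ ((⌊x⌋₊ + 1 : ℕ) : ℝ) := by exact_mod_cast h
    _ ≤ x + 1 := by
      push_cast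
      linarith [Nat.floor_le hx]

theorem coprime_six {q : ℕ} (hq : q.Prime) (h2 : q ≠ 2) (h3 : q ≠ 3) : Nat.Coprime q 6 :=
  Nat.Coprime.mul_right (k := q) (m := 2) (n := 3)
    ((Nat.coprime_primes hq Nat.prime_two).2 h2) ((Nat.coprime_primes hq Nat.prime_three).2 h3)

theorem odd_of_coprime_six {q : ℕ} (h : Nat.Coprime q 6) : ¬ 2 ∣ q := fun h2 =>
  absurd (Nat.eq_one_of_dvd_coprimes h h2 (by norm_num)) (by norm_num)

theorem not_three_dvd_of_coprime_six {q : ℕ} (h : Nat.Coprime q 6) : ¬ 3 ∣ q := fun h3 =>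
  absurd (Nat.eq_one_of_dvd_coprimes h h3 (by norm_num)) (by norm_num)

theorem ncard_eval_eq_le_one {a : ℕ} (ha : 0 < a) (b k : ℕ) :
    {n : ℕ | a * n + b = k}.ncard ≤ 1 := by
  have hs : {n : ℕ | a * n + b = k}.Subsingleton := fun m hm n hn =>
    Nat.eq_of_mul_eq_mul_left ha (Nat.add_right_cancel (hm.trans hn.symm))
  exact (Set.ncard_le_one hs.finite).2 fun _ hm _ hn => hs hm hn

namespace PieceForms

variable {i j α γ M : ℕ} (F : PieceForms i j α γ M)

theorem forall_prime_iff (n : ℕ) :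
    (∀ k : Fin 3, ∃ pr : ℕ, pr.Prime ∧ F.lead k * (n : ℤ) + F.const k = (pr : ℤ)) ↔
      (M * n + F.c).Prime ∧ (F.aq * n + F.bq).Prime ∧ (F.ar * n + F.br).Prime := by
  have key (a b : ℕ) : (∃ pr : ℕ, pr.Prime ∧ (a : ℤ) * (n : ℤ) + (b : ℤ) = (pr : ℤ)) ↔
      (a * n + b).Prime := by
    constructor
    · rintro ⟨pr, h1, h2⟩
      have : a * n + b = pr := by exact_mod_cast h2
      rwa [this]
    · intro h
      exact ⟨_, h, by push_cast; ring⟩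
  rw [Fin.forall_fin_succ, Fin.forall_fin_two, ← key, ← key, ← key]
  rfl

theorem eval_add_one (n : ℕ) :
    M * n + F.c + 1 = 2 ^ α * 3 ^ (j + 1) * (F.aq * n + F.bq) := by
  rw [mul_add, ← mul_assoc, F.modulus_q, F.const_q, add_assoc]

theorem eval_eq (n : ℕ) : M * n + F.c = 2 ^ γ * (F.ar * n + F.br) + 1 := by
  rw [mul_add, ← mul_assoc, F.modulus_r, add_assoc, F.const_r]

theorem exists_eval_eq {p : ℕ} (hp : p ∈ piece α (j + 1) γ) : ∃ n, M * n + F.c = p := by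
  obtain ⟨hpp, q, r, -, -, -, -, hq, hr⟩ := hp
  have hp1 : p = 2 ^ γ * r + 1 := by
    have := hpp.one_lt
    omega
  have e1 : p ≡ F.c [MOD 2 ^ γ] := by
    rw [hp1, ← F.const_r]
    simp [Nat.ModEq, Nat.add_mod]
  have e2 : p ≡ F.c [MOD 2 ^ α * 3 ^ (j + 1)] := by
    refine Nat.ModEq.add_right_cancel' 1 ?_
    rw [hq, ← F.const_q]
    simp [Nat.ModEq]
  have e3 : p ≡ F.c [MOD 2 ^ (i + 2)] := by
    rcases F.exponents with ⟨h, -⟩ | ⟨-, h⟩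
    · exact (e2.of_mul_right _).of_dvd (by rw [h])
    · exact e1.of_dvd (by rw [h])
  have e4 : p ≡ F.c [MOD 2 ^ (i + 2) * 3 ^ (j + 1)] :=
    (Nat.modEq_and_modEq_iff_modEq_mul (Nat.Coprime.pow _ _ (by norm_num))).1
      ⟨e3, e2.of_mul_left _⟩
  have e5 : p % M = F.c := by
    have h : p % M = F.c % M := F.modulus_eq.symm ▸ e4
    rw [h, Nat.mod_eq_of_lt F.const_lt]
  exact ⟨p / M, by rw [← e5, Nat.div_add_mod]⟩

theorem ncard_piece_le (x : ℝ) : (piece α (j + 1) γ ∩ {n : ℕ | (n : ℝ) ≤ x}).ncard ≤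
    primeTupleCount 3 F.lead F.const ((x - F.c) / M) := by
  have hM : (0 : ℝ) < M := by exact_mod_cast F.modulus_pos
  refine (Set.ncard_le_ncard (t := (fun n => M * n + F.c) '' _) ?_
    ((finite_primeTuples 3 F.lead F.const ((x - F.c) / M)).image _)).trans
    (Set.ncard_image_le (finite_primeTuples _ _ _ _))
  rintro p ⟨hp, hpx⟩
  obtain ⟨n, hn⟩ := F.exists_eval_eq hp
  obtain ⟨hpp, q, r, hq, hr, -, -, hq', hr'⟩ := hp
  refine ⟨n, ⟨?_, (F.forall_prime_iff n).2 ⟨hn ▸ hpp, ?_, ?_⟩⟩, hn⟩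
  · rw [le_div_iff₀ hM, le_sub_iff_add_le]
    have : ((M * n + F.c : ℕ) : ℝ) ≤ x := by rw [hn]; exact hpx
    push_cast at this
    linarith
  · have h := F.eval_add_one n
    rw [hn, hq'] at h
    rwa [← Nat.eq_of_mul_eq_mul_left (by positivity) h]
  · have h := F.eval_eq n
    have h2 : p = 2 ^ γ * r + 1 := by
      have := hpp.one_lt
      omega
    rw [hn, h2] at h
    rwa [← Nat.eq_of_mul_eq_mul_left (by positivity) (Nat.add_right_cancel h)]

theorem primeTupleCount_le_ncard_piece (x : ℝ) :
    primeTupleCount 3 F.lead F.const ((x - F.c) / M) ≤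
      (piece α (j + 1) γ ∩ {n : ℕ | (n : ℝ) ≤ x}).ncard + 4 := by
  have hM : (0 : ℝ) < M := by exact_mod_cast F.modulus_pos
  set P := piece α (j + 1) γ ∩ {n : ℕ | (n : ℝ) ≤ x} with hP
  set f : ℕ → ℕ := fun n => M * n + F.c with hf
  have hinj : f.Injective := fun m n h =>
    Nat.eq_of_mul_eq_mul_left F.modulus_pos (Nat.add_right_cancel h)
  have hfin : (f ⁻¹' P).Finite := (finite_inter_le _ x).preimage hinj.injOn
  let E (a b k : ℕ) : Set ℕ := {n | a * n + b = k}
  have hEfin (k : ℕ) {a b : ℕ} (ha : 0 < a) : (E a b k).Finite :=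
    Set.Subsingleton.finite fun m hm n hn =>
      Nat.eq_of_mul_eq_mul_left ha (Nat.add_right_cancel (hm.trans hn.symm))
  have hsub : {n : ℕ | (n : ℝ) ≤ (x - F.c) / M ∧ ∀ k, ∃ pr : ℕ, pr.Prime ∧
      F.lead k * (n : ℤ) + F.const k = (pr : ℤ)} ⊆
      f ⁻¹' P ∪ ((E F.aq F.bq 2 ∪ E F.aq F.bq 3) ∪ (E F.ar F.br 2 ∪ E F.ar F.br 3)) := by
    rintro n ⟨hnx, hn⟩
    obtain ⟨h1, h2, h3⟩ := (F.forall_prime_iff n).1 hn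
    by_contra hcon
    simp only [Set.mem_union, not_or] at hcon
    obtain ⟨h4, ⟨h5, h6⟩, h7, h8⟩ := hcon
    have h9 := F.eval_add_one n
    have h10 := F.eval_eq n
    refine h4 ⟨⟨h1, _, _, h2, h3, coprime_six h2 h5 h6, coprime_six h3 h7 h8, h9, ?_⟩, ?_⟩
    · simp only [hf]
      omega
    · rw [le_div_iff₀ hM, le_sub_iff_add_le] at hnx
      simp only [hf, Set.mem_ofPred_eq]
      push_cast
      linarith
  have hE2 {a b : ℕ} (ha : 0 < a) : (E a b 2 ∪ E a b 3).ncard ≤ 2 :=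
    (Set.ncard_union_le _ _).trans
      (add_le_add (ncard_eval_eq_le_one ha b 2) (ncard_eval_eq_le_one ha b 3))
  have hEE (a b : ℕ) (ha : 0 < a) : (E a b 2 ∪ E a b 3).Finite :=
    (hEfin 2 ha).union (hEfin 3 ha)
  have hpre : (f ⁻¹' P).ncard ≤ P.ncard := by
    rw [← Set.ncard_image_of_injective _ hinj]
    exact Set.ncard_le_ncard (Set.image_preimage_subset f P) (finite_inter_le _ x)
  calc primeTupleCount 3 F.lead F.const ((x - F.c) / M)
      ≤ (f ⁻¹' P ∪ ((E F.aq F.bq 2 ∪ E F.aq F.bq 3) ∪ (E F.ar F.br 2 ∪ E F.ar F.br 3))).ncard :=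
        Set.ncard_le_ncard hsub
          (hfin.union ((hEE F.aq F.bq F.aq_pos).union (hEE F.ar F.br F.ar_pos)))
    _ ≤ P.ncard + (2 + 2) :=
        (Set.ncard_union_le _ _).trans (add_le_add hpre
          ((Set.ncard_union_le _ _).trans (add_le_add (hE2 F.aq_pos) (hE2 F.ar_pos))))

theorem modulus_le_sq (F : PieceForms i j α γ M) {p : ℕ} (hp : p ∈ piece α (j + 1) γ) :
    M ≤ p ^ 2 := by
  obtain ⟨hpp, q, r, hq, hr, hq6, hr6, hq', hr'⟩ := hp
  have h1 : 2 ^ α * 3 ^ (j + 1) * 2 ≤ p + 1 := hq' ▸ Nat.mul_le_mul_left _ hq.two_le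
  have h2 : 2 ^ γ ≤ p - 1 := hr' ▸ Nat.le_mul_of_pos_right _ hr.pos
  have h3 : M ≤ (2 ^ α * 3 ^ (j + 1)) * 2 ^ γ := by
    rw [F.modulus_eq]
    rcases F.exponents with ⟨h, h'⟩ | ⟨h, h'⟩ <;> rw [h, h'] <;>
      nlinarith [Nat.zero_le (2 ^ (i + 2) * 3 ^ (j + 1))]
  have := hpp.one_lt
  calc M ≤ (2 ^ α * 3 ^ (j + 1)) * 2 ^ γ := h3
    _ ≤ p * p := Nat.mul_le_mul (by omega) (by omega)
    _ = p ^ 2 := (sq p).symm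

end PieceForms

/-- Indices of the pieces: the sign tells whether `p + 1` or `p - 1` is divisible by `4`. -/
abbrev PieceIndex : Type := Bool × ℕ × ℕ

/-- The exponent of `2` in `p + 1` on the piece of index `t`. -/
def expPlus (t : PieceIndex) : ℕ := bif t.1 then t.2.1 + 2 else 1

/-- The exponent of `2` in `p - 1` on the piece of index `t`. -/
def expMinus (t : PieceIndex) : ℕ := bif t.1 then 1 else t.2.1 + 2

/-- The modulus of the residue class containing the piece of index `t`. -/
def pieceModulus (t : PieceIndex) : ℕ := 2 ^ (t.2.1 + 2) * 3 ^ (t.2.2 + 1)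

/-- The piece of index `t` of the set `A`. -/
def indexedPiece (t : PieceIndex) : Set ℕ := piece (expPlus t) (t.2.2 + 1) (expMinus t)

theorem nonempty_pieceForms (t : PieceIndex) :
    Nonempty (PieceForms t.2.1 t.2.2 (expPlus t) (expMinus t) (pieceModulus t)) :=
  PieceForms.nonempty (by
    obtain ⟨_ | _, i, j⟩ := t
    · exact Or.inr ⟨rfl, rfl⟩
    · exact Or.inl ⟨rfl, rfl⟩)

theorem indexedPiece_subset (t : PieceIndex) : indexedPiece t ⊆ A := by
  rintro p ⟨hp, q, r, hq, hr, hq6, hr6, hq', hr'⟩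
  have h3 : 3 ∣ p + 1 := hq' ▸ ((dvd_pow_self 3 (by omega)).mul_left _).mul_right _
  refine ⟨hp, by omega, expPlus t, t.2.2 + 1, expMinus t, q, r, ?_, by omega, ?_, hq, hr, hq6, hr6,
    hq', hr'⟩
  · obtain ⟨_ | _, i, j⟩ := t <;> simp [expPlus]
  · obtain ⟨_ | _, i, j⟩ := t <;> simp [expMinus]

theorem exists_mem_indexedPiece {p : ℕ} (hp : p ∈ A) : ∃ t, p ∈ indexedPiece t := by
  obtain ⟨hpp, -, α, β, γ, q, r, hα, hβ, hγ, hq, hr, hq6, hr6, hq', hr'⟩ := hp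
  obtain ⟨j, rfl⟩ : ∃ j, β = j + 1 := ⟨β - 1, by omega⟩
  have hp2 : 1 < p := hpp.one_lt
  have hq2 := odd_of_coprime_six hq6
  have hr2 := odd_of_coprime_six hr6
  rcases Nat.lt_or_ge 1 α with hα2 | hα2
  · obtain ⟨i, rfl⟩ : ∃ i, α = i + 2 := ⟨α - 2, by omega⟩
    have h1 : γ = 1 := by
      by_contra h
      obtain ⟨k, rfl⟩ : ∃ k, γ = k + 2 := ⟨γ - 2, by omega⟩
      have e1 : 2 ^ (i + 2) * 3 ^ (j + 1) * q = 4 * (2 ^ i * 3 ^ (j + 1) * q) := by ring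
      have e2 : 2 ^ (k + 2) * r = 4 * (2 ^ k * r) := by ring
      omega
    subst h1
    exact ⟨(true, i, j), hpp, q, r, hq, hr, hq6, hr6, hq', hr'⟩
  · obtain rfl : α = 1 := by omega
    obtain ⟨i, rfl⟩ : ∃ i, γ = i + 2 := by
      refine ⟨γ - 2, ?_⟩
      by_contra h
      obtain rfl : γ = 1 := by omega
      have e1 : 2 ^ 1 * 3 ^ (j + 1) * q = 2 * (3 ^ (j + 1) * q) := by ring
      have e2 : ¬ 2 ∣ 3 ^ (j + 1) * q := by
        rw [Nat.prime_two.dvd_mul]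
        rintro (h | h)
        · have := Nat.prime_two.dvd_of_dvd_pow h
          omega
        · exact hq2 h
      omega
    exact ⟨(false, i, j), hpp, q, r, hq, hr, hq6, hr6, hq', hr'⟩

theorem pow_mul_left_cancel {l a b m n : ℕ} (hl : l.Prime) (hm : ¬ l ∣ m) (hn : ¬ l ∣ n)
    (h : l ^ a * m = l ^ b * n) : a = b := by
  have key (a m : ℕ) (hm : ¬ l ∣ m) : (l ^ a * m).factorization l = a := by
    have hm0 : m ≠ 0 := fun h0 => hm (h0 ▸ dvd_zero l)
    rw [Nat.factorization_mul (pow_ne_zero _ hl.ne_zero) hm0, Finsupp.add_apply,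
      hl.factorization_pow, Nat.factorization_eq_zero_of_not_dvd hm]
    simp
  rw [← key a m hm, h, key b n hn]

theorem indexedPiece_unique {p : ℕ} {s t : PieceIndex} (hs : p ∈ indexedPiece s)
    (ht : p ∈ indexedPiece t) : s = t := by
  obtain ⟨-, q, r, -, -, hq6, hr6, hq, hr⟩ := hs
  obtain ⟨-, q', r', -, -, hq6', hr6', hq', hr'⟩ := ht
  have h23 (k q : ℕ) (hq6 : Nat.Coprime q 6) : ¬ 2 ∣ 3 ^ k * q := by
    rw [Nat.prime_two.dvd_mul]
    rintro (h | h)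
    · have := Nat.prime_two.dvd_of_dvd_pow h
      omega
    · exact odd_of_coprime_six hq6 h
  have h32 (k q : ℕ) (hq6 : Nat.Coprime q 6) : ¬ 3 ∣ 2 ^ k * q := by
    rw [Nat.prime_three.dvd_mul]
    rintro (h | h)
    · have := Nat.prime_three.dvd_of_dvd_pow h
      omega
    · exact not_three_dvd_of_coprime_six hq6 h
  have e := hq.symm.trans hq'
  have e1 : expPlus s = expPlus t :=
    pow_mul_left_cancel Nat.prime_two (h23 _ _ hq6) (h23 _ _ hq6')
      (by rw [← mul_assoc, ← mul_assoc]; exact e)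
  have e2 : s.2.2 + 1 = t.2.2 + 1 :=
    pow_mul_left_cancel Nat.prime_three (h32 (expPlus s) _ hq6) (h32 (expPlus t) _ hq6')
      (by rw [mul_left_comm, ← mul_assoc, e]; ring)
  have e3 : expMinus s = expMinus t :=
    pow_mul_left_cancel Nat.prime_two (odd_of_coprime_six hr6) (odd_of_coprime_six hr6')
      (hr.symm.trans hr')
  obtain ⟨_ | _, i, j⟩ := s <;> obtain ⟨_ | _, i', j'⟩ := t <;>
    simp_all [expPlus, expMinus]

/-- The number of elements of the piece of index `t` up to `x`. -/
noncomputable def pieceCount (t : PieceIndex) (x : ℝ) : ℕ :=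
  (indexedPiece t ∩ {n : ℕ | (n : ℝ) ≤ x}).ncard

theorem ncard_A_eq_tsum (x : ℝ) :
    ((A ∩ {n : ℕ | (n : ℝ) ≤ x}).ncard : ℝ) = ∑' t, (pieceCount t x : ℝ) := by
  classical
  have hfin := finite_inter_le A x
  have hex (p : ℕ) : ∃ t, p ∈ A → p ∈ indexedPiece t := by
    by_cases hp : p ∈ A
    · obtain ⟨t, ht⟩ := exists_mem_indexedPiece hp
      exact ⟨t, fun _ => ht⟩
    · exact ⟨(true, 0, 0), fun h => absurd h hp⟩
  choose f hf using hex
  have hfilter (t : PieceIndex) :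
      pieceCount t x = (hfin.toFinset.filter fun p => f p = t).card := by
    rw [pieceCount, ← Set.ncard_coe_finset]
    congr 1
    ext p
    simp only [Finset.coe_filter, Set.Finite.mem_toFinset, Set.mem_ofPred_eq, Set.mem_inter_iff]
    constructor
    · rintro ⟨h1, h2⟩
      have h3 := indexedPiece_subset t h1
      exact ⟨⟨h3, h2⟩, indexedPiece_unique (hf p h3) h1⟩
    · rintro ⟨⟨h1, h2⟩, rfl⟩
      exact ⟨hf p h1, h2⟩
  rw [tsum_eq_sum (s := hfin.toFinset.image f), Set.ncard_eq_toFinset_card _ hfin,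
    Finset.card_eq_sum_card_image f, Nat.cast_sum]
  · exact Finset.sum_congr rfl fun t _ => by rw [hfilter]
  · intro t ht
    rw [hfilter, Nat.cast_eq_zero, Finset.card_eq_zero, Finset.filter_eq_empty_iff]
    exact fun p hp h => ht (Finset.mem_image.2 ⟨p, hp, h⟩)

/-- A fourth root of the modulus of the piece of index `t`. -/
noncomputable def modulusRoot (t : PieceIndex) : ℝ :=
  ((2 : ℝ) ^ (1 / 4 : ℝ)) ^ (t.2.1 + 2) * ((3 : ℝ) ^ (1 / 4 : ℝ)) ^ (t.2.2 + 1)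

theorem rpow_quarter_pow_four {a : ℝ} (ha : 0 ≤ a) : (a ^ (1 / 4 : ℝ)) ^ 4 = a := by
  rw [← Real.rpow_natCast, ← Real.rpow_mul ha]
  norm_num

theorem modulusRoot_pow_four (t : PieceIndex) : modulusRoot t ^ 4 = pieceModulus t := by
  rw [modulusRoot, mul_pow, ← pow_mul, ← pow_mul, mul_comm _ 4, mul_comm _ 4, pow_mul, pow_mul,
    rpow_quarter_pow_four (by norm_num), rpow_quarter_pow_four (by norm_num), pieceModulus]
  push_cast
  rfl

theorem one_le_modulusRoot (t : PieceIndex) : 1 ≤ modulusRoot t :=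
  one_le_mul_of_one_le_of_one_le
    (one_le_pow₀ (Real.one_le_rpow (by norm_num) (by norm_num)))
    (one_le_pow₀ (Real.one_le_rpow (by norm_num) (by norm_num)))

theorem hasSum_bool_prod {f : ℕ × ℕ → ℝ} {a : ℝ} (hf : HasSum f a) (h0 : 0 ≤ f) :
    HasSum (fun t : PieceIndex => f t.2) (2 * a) := by
  have h1 : HasSum (fun _ : Bool => (1 : ℝ)) 2 := by
    simpa using hasSum_fintype fun _ : Bool => (1 : ℝ)
  have h2 := h1.mul hf (h1.summable.mul_of_nonneg hf.summable (fun _ => zero_le_one) h0)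
  simpa only [one_mul] using h2

theorem hasSum_inv_pow_mul_inv_pow {a b : ℝ} (ha : 1 < a) (hb : 1 < b) (k l : ℕ) :
    HasSum (fun t : PieceIndex => (a ^ (t.2.1 + k) * b ^ (t.2.2 + l))⁻¹)
      (2 * ((1 - a⁻¹)⁻¹ * (a ^ k)⁻¹ * ((1 - b⁻¹)⁻¹ * (b ^ l)⁻¹))) := by
  have h (a : ℝ) (ha : 1 < a) (k : ℕ) :
      HasSum (fun i : ℕ => (a ^ (i + k))⁻¹) ((1 - a⁻¹)⁻¹ * (a ^ k)⁻¹) := by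
    have h1 := (hasSum_geometric_of_lt_one (by positivity : 0 ≤ a⁻¹)
      (inv_lt_one_of_one_lt₀ ha)).mul_right ((a ^ k)⁻¹)
    simpa only [inv_pow, ← mul_inv, ← pow_add] using h1
  have hpos (a : ℝ) (ha : 1 < a) (k : ℕ) : 0 ≤ fun i : ℕ => (a ^ (i + k))⁻¹ := fun i =>
    inv_nonneg.2 (pow_nonneg (by linarith) _)
  have h1 := (h a ha k).mul (h b hb l) ((h a ha k).summable.mul_of_nonneg (h b hb l).summable
    (hpos a ha k) (hpos b hb l))
  have h2 := hasSum_bool_prod h1 fun t => mul_nonneg (hpos a ha k t.1) (hpos b hb l t.2)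
  simpa only [← mul_inv] using h2

theorem summable_inv_modulusRoot : Summable fun t : PieceIndex => (modulusRoot t)⁻¹ :=
  (hasSum_inv_pow_mul_inv_pow (Real.one_lt_rpow (by norm_num) (by norm_num))
    (Real.one_lt_rpow (by norm_num) (by norm_num)) 2 1).summable

theorem hasSum_inv_pieceModulus :
    HasSum (fun t : PieceIndex => ((pieceModulus t : ℝ))⁻¹) (1 / 2) := by
  have h := hasSum_inv_pow_mul_inv_pow one_lt_two (by norm_num : (1 : ℝ) < 3) 2 1
  have e : (2 : ℝ) * ((1 - 2⁻¹)⁻¹ * (2 ^ 2)⁻¹ * ((1 - 3⁻¹)⁻¹ * (3 ^ 1)⁻¹)) = 1 / 2 := by norm_num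
  rw [e] at h
  simpa only [pieceModulus, Nat.cast_mul, Nat.cast_pow, Nat.cast_ofNat] using h

theorem tendsto_primeTupleCount (hGHL : GHL) {i j α γ M : ℕ} (F : PieceForms i j α γ M) :
    Filter.Tendsto (fun y : ℝ => (primeTupleCount 3 F.lead F.const y : ℝ) * Real.log y ^ 3 / y)
      Filter.atTop (nhds SA) := by
  rw [Metric.tendsto_atTop]
  intro ε hε
  have hK : 0 < |SA + 1| + 1 := by positivity
  obtain ⟨x₀, hx₀⟩ := hGHL 3 1 (ε / (|SA + 1| + 1)) one_pos (by positivity)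
  obtain ⟨x₁, hx₁⟩ := Filter.eventually_atTop.1
    (Real.tendsto_log_atTop.eventually_ge_atTop (max 1 (M : ℝ)))
  refine ⟨max x₀ (max x₁ 1), fun y hy => ?_⟩
  simp only [ge_iff_le, max_le_iff] at hy
  obtain ⟨hy0, hy1, hy2⟩ := hy
  have hlog := max_le_iff.1 (hx₁ y hy1)
  have hL : 0 < Real.log y := by linarith [hlog.1]
  have hy3 : 0 < y := by linarith
  have hb := hx₀ y hy0 F.lead F.const F.lead_pos F.isCoprime_lead_const
    (fun k => by
      rw [Real.rpow_one]
      exact ⟨(F.abs_lead_le k).trans hlog.2, (F.abs_const_le k).trans hlog.2⟩)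
    F.multipliable_singFactor
  rw [F.singSeries_eq] at hb
  have hq : 0 < y / Real.log y ^ 3 := by positivity
  have e1 : (primeTupleCount 3 F.lead F.const y : ℝ) * Real.log y ^ 3 / y - SA =
      ((primeTupleCount 3 F.lead F.const y : ℝ) - SA * y / Real.log y ^ 3) /
        (y / Real.log y ^ 3) := by
    field_simp
  rw [Real.dist_eq, e1, abs_div, abs_of_pos hq, div_lt_iff₀ hq]
  refine hb.trans_lt ?_
  rw [mul_div_assoc]
  refine mul_lt_mul_of_pos_right ?_ hq
  calc ε / (|SA + 1| + 1) * (SA + 1) ≤ ε / (|SA + 1| + 1) * |SA + 1| := by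
        gcongr
        exact le_abs_self _
    _ < ε / (|SA + 1| + 1) * (|SA + 1| + 1) := by
        gcongr
        linarith
    _ = ε := by field_simp

theorem tendsto_sub_div_atTop (c : ℝ) {m : ℝ} (hm : 0 < m) :
    Filter.Tendsto (fun x : ℝ => (x - c) / m) Filter.atTop Filter.atTop :=
  (Filter.tendsto_atTop_add_const_right _ (-c) Filter.tendsto_id).atTop_div_const hm

theorem tendsto_sub_div_div (c m : ℝ) :
    Filter.Tendsto (fun x : ℝ => (x - c) / m / x) Filter.atTop (nhds m⁻¹) := by
  have h : Filter.Tendsto (fun x : ℝ => (1 - c / x) * m⁻¹) Filter.atTop (nhds ((1 - 0) * m⁻¹)) :=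
    (tendsto_const_nhds.sub (Filter.Tendsto.const_div_atTop Filter.tendsto_id c)).mul_const _
  rw [sub_zero, one_mul] at h
  refine h.congr' ?_
  filter_upwards [Filter.eventually_gt_atTop 0] with x hx
  field_simp

theorem tendsto_log_div_log_sub_div (c : ℝ) {m : ℝ} (hm : 0 < m) :
    Filter.Tendsto (fun x : ℝ => Real.log x / Real.log ((x - c) / m)) Filter.atTop (nhds 1) := by
  have h1 := (tendsto_sub_div_div c m).log (inv_ne_zero hm.ne')
  have h2 : Filter.Tendsto (fun x : ℝ => 1 + Real.log ((x - c) / m / x) / Real.log x) Filter.atTop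
      (nhds (1 + 0)) := tendsto_const_nhds.add (h1.div_atTop Real.tendsto_log_atTop)
  have h3 := h2.inv₀ (by norm_num)
  rw [add_zero, inv_one] at h3
  refine h3.congr' ?_
  filter_upwards [Filter.eventually_gt_atTop 1, Filter.eventually_gt_atTop c] with x hx hxc
  have hx0 : 0 < x := by linarith
  have hy : 0 < (x - c) / m := div_pos (by linarith) hm
  have hL := Real.log_pos hx
  rw [Real.log_div hy.ne' hx0.ne', sub_div, div_self hL.ne', add_sub_cancel, inv_div]

theorem tendsto_log_pow_div_atTop :
    Filter.Tendsto (fun x : ℝ => Real.log x ^ 3 / x) Filter.atTop (nhds 0) := by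
  have h := (isLittleO_log_rpow_rpow_atTop 3 one_pos).tendsto_div_nhds_zero
  refine h.congr fun x => ?_
  rw [Real.rpow_one, Real.rpow_ofNat]

theorem tendsto_pieceCount (hGHL : GHL) (t : PieceIndex) :
    Filter.Tendsto (fun x : ℝ => (pieceCount t x : ℝ) * Real.log x ^ 3 / x) Filter.atTop
      (nhds (SA * (pieceModulus t : ℝ)⁻¹)) := by
  obtain ⟨F⟩ := nonempty_pieceForms t
  have hM : (0 : ℝ) < pieceModulus t := by exact_mod_cast F.modulus_pos
  let m : ℝ := pieceModulus t
  let c : ℝ := F.c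
  have h1 := (tendsto_primeTupleCount hGHL F).comp (tendsto_sub_div_atTop c hM)
  have h2 := (h1.mul (tendsto_sub_div_div c m)).mul ((tendsto_log_div_log_sub_div c hM).pow 3)
  have h3 : Filter.Tendsto (fun x : ℝ => (primeTupleCount 3 F.lead F.const ((x - c) / m) : ℝ) *
      Real.log x ^ 3 / x) Filter.atTop (nhds (SA * m⁻¹)) := by
    rw [one_pow, mul_one] at h2
    refine h2.congr' ?_
    filter_upwards [Filter.eventually_gt_atTop 0,
      (tendsto_sub_div_atTop c hM).eventually_gt_atTop 1] with x hx hy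
    have hL := (Real.log_pos hy).ne'
    have hy0 : (x - c) / m ≠ 0 := by linarith
    simp only [Function.comp_apply]
    generalize (x - c) / m = y at *
    field_simp
  have h4 : Filter.Tendsto (fun x : ℝ => (primeTupleCount 3 F.lead F.const ((x - c) / m) : ℝ) *
      Real.log x ^ 3 / x - 4 * (Real.log x ^ 3 / x)) Filter.atTop (nhds (SA * m⁻¹ - 4 * 0)) :=
    h3.sub (tendsto_log_pow_div_atTop.const_mul 4)
  rw [mul_zero, sub_zero] at h4
  refine tendsto_of_tendsto_of_tendsto_of_le_of_le' h4 h3 ?_ ?_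
  · filter_upwards [Filter.eventually_gt_atTop 1] with x hx
    have hL := Real.log_pos hx
    have h5 : (primeTupleCount 3 F.lead F.const ((x - c) / m) : ℝ) ≤ pieceCount t x + 4 := by
      exact_mod_cast F.primeTupleCount_le_ncard_piece x
    have h6 : 0 ≤ Real.log x ^ 3 / x := by positivity
    rw [mul_div_assoc, mul_div_assoc]
    nlinarith
  · filter_upwards [Filter.eventually_gt_atTop 1] with x hx
    have hL := Real.log_pos hx
    have h5 : (pieceCount t x : ℝ) ≤ primeTupleCount 3 F.lead F.const ((x - c) / m) := by
      exact_mod_cast F.ncard_piece_le x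
    gcongr

theorem pieceCount_le (hGHL : GHL) : ∃ K : ℝ, ∀ᶠ x : ℝ in Filter.atTop, ∀ t : PieceIndex,
    ‖(pieceCount t x : ℝ) * Real.log x ^ 3 / x‖ ≤ K * (modulusRoot t)⁻¹ := by
  obtain ⟨x₀, hx₀⟩ := hGHL 3 5 1 (by norm_num) one_pos
  refine ⟨8 * |2 * SA + 1| + 2, ?_⟩
  have hpow : ∀ᶠ x : ℝ in Filter.atTop, Real.log x ^ 4 ≤ √x := by
    have h := (isLittleO_log_rpow_rpow_atTop 4 (by norm_num : (0 : ℝ) < 1 / 2)).bound one_pos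
    filter_upwards [h] with x hx
    rw [one_mul, ← Real.sqrt_eq_rpow, Real.rpow_ofNat, Real.norm_eq_abs, Real.norm_eq_abs,
      abs_of_nonneg (Real.sqrt_nonneg x)] at hx
    exact (le_abs_self _).trans hx
  filter_upwards [hpow, Real.tendsto_log_atTop.eventually_ge_atTop 32,
    Real.tendsto_sqrt_atTop.eventually_ge_atTop x₀, Filter.eventually_gt_atTop 1]
    with x hx4 hL hxs hx1 t
  obtain ⟨F⟩ := nonempty_pieceForms t
  obtain ⟨L, hLdef⟩ : ∃ L, L = Real.log x := ⟨_, rfl⟩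
  obtain ⟨s, hs⟩ : ∃ s, s = √x := ⟨_, rfl⟩
  obtain ⟨m, hm⟩ : ∃ m, m = modulusRoot t := ⟨_, rfl⟩
  have hm4 : m ^ 4 = pieceModulus t := hm ▸ modulusRoot_pow_four t
  have hm1 : 1 ≤ m := hm ▸ one_le_modulusRoot t
  have hx0 : 0 < x := by linarith
  have hs0 : 0 < s := hs ▸ Real.sqrt_pos.2 hx0
  have hsx : s ^ 2 = x := hs ▸ Real.sq_sqrt hx0.le
  rw [← hm, ← hLdef, Real.norm_of_nonneg (by rw [hLdef] at *; positivity)]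
  rw [← hLdef, ← hs] at hx4
  rw [← hLdef] at hL
  rw [← hs] at hxs
  have hM : (0 : ℝ) < pieceModulus t := by exact_mod_cast F.modulus_pos
  have hcount : (pieceCount t x : ℝ) ≤ primeTupleCount 3 F.lead F.const (x / pieceModulus t) := by
    have h1 : pieceCount t x ≤ _ := F.ncard_piece_le x
    exact_mod_cast h1.trans (primeTupleCount_mono _ _ (by
      gcongr
      exact sub_le_self _ (Nat.cast_nonneg _)))
  rw [← hm4] at hcount hM
  have hK : 0 ≤ |2 * SA + 1| := abs_nonneg _
  rcases le_or_gt (m ^ 4) (L ^ 4) with hML | hML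
  · have hz : s ≤ x / m ^ 4 := by
      rw [le_div_iff₀ hM, ← hsx, sq]
      gcongr
      exact hML.trans hx4
    obtain ⟨z, hzdef⟩ : ∃ z, z = x / m ^ 4 := ⟨_, rfl⟩
    rw [← hzdef] at hz hcount
    have hz0 : 0 < z := hs0.trans_le hz
    have hlogz : L / 2 ≤ Real.log z := by
      have h1 : Real.log s = L / 2 := by rw [hs, Real.log_sqrt hx0.le, hLdef]
      exact h1 ▸ Real.log_le_log hs0 hz
    have hbd : (pieceModulus t : ℝ) ≤ Real.log z ^ (5 : ℝ) := by
      rw [← hm4, Real.rpow_ofNat]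
      calc m ^ 4 ≤ L ^ 4 := hML
        _ ≤ (2 * Real.log z) ^ 4 := by gcongr; linarith
        _ = 16 * Real.log z ^ 4 := by ring
        _ ≤ Real.log z * Real.log z ^ 4 := by gcongr; linarith
        _ = Real.log z ^ 5 := by ring
    have hb := hx₀ z (hxs.trans hz) F.lead F.const F.lead_pos F.isCoprime_lead_const
      (fun k => ⟨(F.abs_lead_le k).trans hbd, (F.abs_const_le k).trans hbd⟩)
      F.multipliable_singFactor
    rw [F.singSeries_eq] at hb
    have h2 : (pieceCount t x : ℝ) ≤ |2 * SA + 1| * (z / (L / 2) ^ 3) := by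
      calc (pieceCount t x : ℝ) ≤ _ := hcount
        _ ≤ SA * z / Real.log z ^ 3 + 1 * (SA + 1) * z / Real.log z ^ 3 := by
            linarith [(abs_le.1 hb).2]
        _ = (2 * SA + 1) * (z / Real.log z ^ 3) := by ring
        _ ≤ |2 * SA + 1| * (z / (L / 2) ^ 3) := by
            have hl : 0 < Real.log z := by linarith
            gcongr
            exact le_abs_self _
    calc (pieceCount t x : ℝ) * L ^ 3 / x ≤ |2 * SA + 1| * (z / (L / 2) ^ 3) * L ^ 3 / x := by
          gcongr
      _ = 8 * |2 * SA + 1| * (m ^ 4)⁻¹ := by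
          have hL0 : L ≠ 0 := by linarith
          rw [hzdef]
          field_simp
          ring
      _ ≤ (8 * |2 * SA + 1| + 2) * m⁻¹ := by
          gcongr
          · linarith
          · exact le_self_pow₀ hm1 (by norm_num)
  · rcases Nat.eq_zero_or_pos (pieceCount t x) with h0 | hpos
    · rw [h0]
      simp only [Nat.cast_zero, zero_mul, zero_div]
      positivity
    · obtain ⟨p, hp, hpx⟩ := Set.nonempty_of_ncard_ne_zero hpos.ne'
      have hms : m ≤ s := by
        refine le_of_pow_le_pow_left₀ (n := 4) (by norm_num) hs0.le ?_
        calc m ^ 4 = pieceModulus t := hm4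
          _ ≤ (p : ℝ) ^ 2 := by exact_mod_cast F.modulus_le_sq hp
          _ ≤ x ^ 2 := by
            gcongr
            exact hpx
          _ = s ^ 4 := by rw [← hsx]; ring
      have hLm : L ≤ m := le_of_pow_le_pow_left₀ (n := 4) (by norm_num) (by linarith) hML.le
      have h1 : (pieceCount t x : ℝ) ≤ x / m ^ 4 + 1 :=
        hcount.trans (primeTupleCount_le _ _ (by positivity))
      have hm0 : 0 < m := by linarith
      have e1 : L ^ 3 / m ^ 4 ≤ m⁻¹ := by
        rw [div_le_iff₀ hM]
        calc L ^ 3 ≤ m ^ 3 := by gcongr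
          _ = m⁻¹ * m ^ 4 := by field_simp
      have e2 : L ^ 3 / x ≤ m⁻¹ := by
        calc L ^ 3 / x ≤ s / x := by
              gcongr
              refine le_trans ?_ hx4
              exact pow_le_pow_right₀ (by linarith) (by norm_num)
          _ = s⁻¹ := by rw [← hsx]; field_simp
          _ ≤ m⁻¹ := by gcongr
      calc (pieceCount t x : ℝ) * L ^ 3 / x ≤ (x / m ^ 4 + 1) * L ^ 3 / x := by gcongr
        _ = L ^ 3 / m ^ 4 + L ^ 3 / x := by field_simp
        _ ≤ 2 * m⁻¹ := by linarith
        _ ≤ (8 * |2 * SA + 1| + 2) * m⁻¹ := by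
          gcongr
          linarith

theorem A_density (hGHL : GHL) :
    Filter.Tendsto
      (fun x : ℝ => ((A ∩ {n : ℕ | (n : ℝ) ≤ x}).ncard : ℝ) * (Real.log x) ^ 3 / x)
      Filter.atTop (nhds (SA / 2)) := by
  obtain ⟨K, hK⟩ := pieceCount_le hGHL
  have h := tendsto_tsum_of_dominated_convergence (summable_inv_modulusRoot.mul_left K)
    (tendsto_pieceCount hGHL) hK
  rw [(hasSum_inv_pieceModulus.mul_left SA).tsum_eq, mul_one_div] at h
  refine h.congr fun x => ?_
  rw [ncard_A_eq_tsum, mul_div_assoc, ← tsum_mul_right]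
  exact tsum_congr fun t => mul_div_assoc _ _ _
end

section
/- There is an absolute constant c > 0 with the following property. Let f_i(n) = a_i·n + b_i for i = 1, 2, 3, 4 be linear polynomials with integer coefficients such that each a_i is positive and has no prime divisor other than 2 and 3, and gcd(a_i, b_i) = 1 for each i. Let T = ∏_{1 ≤ r < s ≤ 4} (a_r·b_s − a_s·b_r) and suppose T ≠ 0. For each prime ℓ let ρ(ℓ) denote the number of residues n modulo ℓ with f_1(n)·f_2(n)·f_3(n)·f_4(n) ≡ 0 (mod ℓ), and assume ρ(2) ≤ 1 and ρ(3) ≤ 1. Then the product ∏_{ℓ prime} (1 − ρ(ℓ)/ℓ)·(1 − 1/ℓ)^{−4} converges and its value is at most c·(log log(|T| + 16))³. -/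
/-- `ρ(ℓ)`: the number of residues `n` modulo `ℓ` with
`f₁(n) f₂(n) f₃(n) f₄(n) ≡ 0 (mod ℓ)`, where `fᵢ(n) = aᵢ n + bᵢ`. -/
noncomputable def rho4 (a b : Fin 4 → ℤ) (ℓ : ℕ) : ℕ :=
  Set.ncard {n : ZMod ℓ | ∏ i, ((a i : ZMod ℓ) * n + (b i : ZMod ℓ)) = 0}

/-- The product of the pairwise resultants of the four linear polynomials `aᵢ n + bᵢ`. -/
def resultantProd (a b : Fin 4 → ℤ) : ℤ :=
  ∏ p ∈ Finset.univ.filter (fun p : Fin 4 × Fin 4 => p.1 < p.2),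
    (a p.1 * b p.2 - a p.2 * b p.1)

theorem sum_primesLE_log_div_le {n : ℕ} (hn : 0 < n) :
    ∑ p ∈ n.primesLE, Real.log p / p ≤ Real.log n + Real.log 4 := by
  have hn' : (0 : ℝ) < n := by exact_mod_cast hn
  have hdvd : ∏ p ∈ n.primesLE, p ^ (n / p) ∣ n.factorial := by
    refine Finset.prod_dvd_of_isRelPrime ?_ ?_
    · intro p hp q hq hpq
      exact Nat.coprime_iff_isRelPrime.mp (Nat.Coprime.pow _ _
        ((Nat.coprime_primes (Nat.prime_of_mem_primesLE hp) (Nat.prime_of_mem_primesLE hq)).2 hpq))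
    · intro p hp
      have hp' := Nat.prime_of_mem_primesLE hp
      have hpn := Nat.le_of_mem_primesLE hp
      rw [hp'.pow_dvd_factorial_iff (Nat.lt_succ_self _)]
      have h1 : 1 ∈ Finset.Ico 1 (Nat.log p n).succ :=
        Finset.mem_Ico.2 ⟨le_rfl, Nat.succ_lt_succ (Nat.log_pos hp'.one_lt hpn)⟩
      have := Finset.single_le_sum (f := fun i => n / p ^ i) (fun _ _ => Nat.zero_le _) h1
      simpa using this
  have hle : ∏ p ∈ n.primesLE, p ^ (n / p) ≤ n ^ n :=
    (Nat.le_of_dvd n.factorial_pos hdvd).trans (Nat.factorial_le_pow n)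
  have hlog : ∑ p ∈ n.primesLE, ((n / p : ℕ) : ℝ) * Real.log p ≤ n * Real.log n := by
    have hpos : (0 : ℝ) < ∏ p ∈ n.primesLE, (p : ℝ) ^ (n / p) :=
      Finset.prod_pos fun p hp => pow_pos (by exact_mod_cast (Nat.prime_of_mem_primesLE hp).pos) _
    have h := Real.log_le_log hpos (y := (n : ℝ) ^ n) (by exact_mod_cast hle)
    rw [Real.log_pow, Real.log_prod] at h
    · simpa using h
    · intro p hp
      exact pow_ne_zero _ (by exact_mod_cast (Nat.prime_of_mem_primesLE hp).ne_zero)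
  have htheta : ∑ p ∈ n.primesLE, Real.log p ≤ Real.log 4 * n := by
    rw [← Chebyshev.theta_eq_sum_primesLE_log]
    exact Chebyshev.theta_le_log4_mul_x hn'.le
  have hterm : ∑ p ∈ n.primesLE, n * (Real.log p / p) ≤
      ∑ p ∈ n.primesLE, (((n / p : ℕ) : ℝ) * Real.log p + Real.log p) := by
    refine Finset.sum_le_sum fun p hp => ?_
    have hp' := Nat.prime_of_mem_primesLE hp
    have hp0 : (0 : ℝ) < p := by exact_mod_cast hp'.pos
    have h1 : (n : ℝ) / p < (n / p : ℕ) + 1 := by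
      rw [← Nat.floor_div_eq_div (K := ℝ)]
      exact Nat.lt_floor_add_one _
    have h2 : 0 ≤ Real.log p := Real.log_natCast_nonneg p
    calc (n : ℝ) * (Real.log p / p) = n / p * Real.log p := by ring
      _ ≤ ((n / p : ℕ) + 1) * Real.log p := by gcongr
      _ = _ := by ring
  rw [← Finset.mul_sum, Finset.sum_add_distrib] at hterm
  refine le_of_mul_le_mul_left ?_ hn'
  linarith

theorem tsum_nat_rpow_neg_le {s : ℝ} (hs : 1 < s) :
    ∑' n : ℕ, (n : ℝ) ^ (-s) ≤ 1 + 1 / (s - 1) := by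
  have hsum : Summable fun n : ℕ => (n : ℝ) ^ (-s) := Real.summable_nat_rpow.2 (by linarith)
  rw [hsum.tsum_eq_zero_add]
  have h := ZetaAsymptotics.zeta_limit_aux1 hs
  have h0 : 0 ≤ ZetaAsymptotics.termTSum s := tsum_nonneg fun n => ZetaAsymptotics.term_nonneg _ _
  have h1 : ∑' n : ℕ, ((n + 1 : ℕ) : ℝ) ^ (-s) = ∑' n : ℕ, 1 / (n + 1 : ℝ) ^ s := by
    refine tsum_congr fun n => ?_
    rw [Real.rpow_neg (by positivity)]
    simp
  have h2 : ((0 : ℕ) : ℝ) ^ (-s) = 0 := by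
    rw [Nat.cast_zero, Real.zero_rpow (by linarith)]
  rw [h1, h2]
  nlinarith

theorem prod_primesBelow_rpow_le {s : ℝ} (hs : 1 < s) (N : ℕ) :
    ∏ p ∈ N.primesBelow, (1 - (p : ℝ) ^ (-s))⁻¹ ≤ 1 + 1 / (s - 1) := by
  let f : ℕ →* ℝ :=
    { toFun := fun n => (n : ℝ) ^ (-s)
      map_one' := by simp
      map_mul' := fun m n => by
        rw [Nat.cast_mul, Real.mul_rpow (Nat.cast_nonneg m) (Nat.cast_nonneg n)] }
  have hsum : Summable f := Real.summable_nat_rpow.2 (by linarith)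
  refine (EulerProduct.prod_primesBelow_geometric_eq_tsum_smoothNumbers hsum N).le.trans ?_
  refine (hsum.tsum_subtype_le _ _ fun n => ?_).trans (tsum_nat_rpow_neg_le hs)
  exact Real.rpow_nonneg (Nat.cast_nonneg n) _

theorem prod_primesLE_le {n : ℕ} (hn : 2 ≤ n) :
    ∏ p ∈ n.primesLE, (1 - 1 / (p : ℝ))⁻¹ ≤ Real.exp 6 * (1 + Real.log n) := by
  have hn2 : (2 : ℝ) ≤ n := by exact_mod_cast hn
  have hlog2 : 0 < Real.log 2 := Real.log_pos one_lt_two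
  have hlogle : Real.log 2 ≤ Real.log n := Real.log_le_log two_pos hn2
  have hlog : 0 < Real.log n := hlog2.trans_le hlogle
  have hlog4 : Real.log 4 ≤ 2 * Real.log n := by
    rw [show (4 : ℝ) = 2 ^ 2 by norm_num, Real.log_pow]
    push_cast
    linarith
  set δ : ℝ := 1 / Real.log n with hδ
  have hδ0 : 0 < δ := by positivity
  have hterm : ∀ p ∈ n.primesLE, (1 - 1 / (p : ℝ))⁻¹ ≤
      (1 - (p : ℝ) ^ (-(1 + δ)))⁻¹ * Real.exp (2 * δ * (Real.log p / p)) := by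
    intro p hp
    have hp2 : (2 : ℝ) ≤ p := by exact_mod_cast Nat.two_le_of_mem_primesLE hp
    have hp0 : (0 : ℝ) < p := by linarith
    have hlp : 0 ≤ Real.log p := Real.log_natCast_nonneg p
    have hx2 : 1 / (p : ℝ) ≤ 1 / 2 := one_div_le_one_div_of_le two_pos hp2
    have hpow : (p : ℝ) ^ (-(1 + δ)) = 1 / p * Real.exp (-(δ * Real.log p)) := by
      rw [neg_add, Real.rpow_add hp0, Real.rpow_neg_one, one_div, Real.rpow_def_of_pos hp0]
      congr 2
      ring
    have hexp : 1 - δ * Real.log p ≤ Real.exp (-(δ * Real.log p)) := by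
      linarith [Real.add_one_le_exp (-(δ * Real.log p))]
    have hexp1 : Real.exp (-(δ * Real.log p)) ≤ 1 :=
      Real.exp_le_one_iff.2 (neg_nonpos.2 (by positivity))
    have hx0 : 0 < 1 / (p : ℝ) := by positivity
    have hlow : 1 / (p : ℝ) - δ * (Real.log p / p) ≤ (p : ℝ) ^ (-(1 + δ)) := by
      rw [hpow]
      calc 1 / (p : ℝ) - δ * (Real.log p / p) = 1 / p * (1 - δ * Real.log p) := by ring
        _ ≤ _ := by gcongr
    have hup : (p : ℝ) ^ (-(1 + δ)) ≤ 1 / 2 := by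
      rw [hpow]
      nlinarith [Real.exp_pos (-(δ * Real.log p))]
    have hE := Real.add_one_le_exp (2 * δ * (Real.log p / p))
    have hq0 : 0 ≤ δ * (Real.log p / p) := by positivity
    rw [← div_eq_inv_mul, inv_eq_one_div, div_le_div_iff₀ (by linarith) (by linarith), one_mul]
    nlinarith
  calc ∏ p ∈ n.primesLE, (1 - 1 / (p : ℝ))⁻¹
      ≤ ∏ p ∈ n.primesLE,
          ((1 - (p : ℝ) ^ (-(1 + δ)))⁻¹ * Real.exp (2 * δ * (Real.log p / p))) := by
        refine Finset.prod_le_prod (fun p hp => ?_) hterm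
        have hp2 : (2 : ℝ) ≤ p := by exact_mod_cast Nat.two_le_of_mem_primesLE hp
        have hx2 : 1 / (p : ℝ) ≤ 1 / 2 := one_div_le_one_div_of_le two_pos hp2
        exact inv_nonneg.2 (by linarith)
    _ = (∏ p ∈ n.primesLE, (1 - (p : ℝ) ^ (-(1 + δ)))⁻¹) *
          Real.exp (2 * δ * ∑ p ∈ n.primesLE, Real.log p / p) := by
        rw [Finset.prod_mul_distrib, ← Real.exp_sum, Finset.mul_sum]
    _ ≤ (1 + Real.log n) * Real.exp 6 := by
        have h1 := prod_primesBelow_rpow_le (s := 1 + δ) (by linarith) (n + 1)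
        have h2 : 1 / (1 + δ - 1) = Real.log n := by rw [hδ]; simp
        rw [h2] at h1
        have h3 : 2 * δ * ∑ p ∈ n.primesLE, Real.log p / p ≤ 6 := by
          calc 2 * δ * ∑ p ∈ n.primesLE, Real.log p / p ≤ 2 * δ * (3 * Real.log n) := by
                gcongr
                linarith [sum_primesLE_log_div_le (n := n) (by omega)]
            _ = 6 := by rw [hδ]; field_simp; norm_num
        exact mul_le_mul h1 (Real.exp_le_exp.2 h3) (Real.exp_pos _).le (by linarith)
    _ = _ := mul_comm _ _

theorem one_sub_one_div_inv_le_exp {x : ℝ} (hx : 2 ≤ x) :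
    (1 - 1 / x)⁻¹ ≤ Real.exp (2 / x) := by
  have hx0 : 0 < x := by linarith
  have hx2 : 1 / x ≤ 1 / 2 := one_div_le_one_div_of_le two_pos hx
  have hx1 : 0 < 1 / x := by positivity
  have h := Real.add_one_le_exp (2 / x)
  have h2 : 2 / x = 2 * (1 / x) := by ring
  rw [inv_le_iff_one_le_mul₀ (by linarith)]
  rw [h2] at h ⊢
  nlinarith

theorem one_le_one_sub_one_div_inv {x : ℝ} (hx : 2 ≤ x) : 1 ≤ (1 - 1 / x)⁻¹ := by
  have hx2 : 1 / x ≤ 1 / 2 := one_div_le_one_div_of_le two_pos hx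
  have hx1 : 0 < 1 / x := by positivity
  exact (one_le_inv₀ (by linarith)).2 (by linarith)

theorem one_le_log_log {x : ℝ} (hx : 16 ≤ x) : 1 ≤ Real.log (Real.log x) := by
  have h16 : Real.log 16 = 4 * Real.log 2 := by
    rw [show (16 : ℝ) = 2 ^ 4 by norm_num, Real.log_pow]
    norm_num
  have h1 : Real.log 16 ≤ Real.log x := Real.log_le_log (by norm_num) hx
  have h2 : Real.exp 1 ≤ Real.log x := by
    linarith [Real.exp_one_lt_d9, Real.log_two_gt_d9]
  exact (Real.le_log_iff_exp_le ((Real.exp_pos 1).trans_le h2)).2 h2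

theorem card_primeFactors_mul_log_two_le {T : ℕ} (hT : T ≠ 0) :
    (T.primeFactors.card : ℝ) * Real.log 2 ≤ Real.log T := by
  have h : 2 ^ T.primeFactors.card ≤ T :=
    (Finset.pow_card_le_prod T.primeFactors (fun p => p) 2
      fun p hp => (Nat.prime_of_mem_primeFactors hp).two_le).trans
      (Nat.le_of_dvd (Nat.pos_of_ne_zero hT) (Nat.prod_primeFactors_dvd T))
  rw [← Real.log_pow]
  exact Real.log_le_log (by positivity) (by exact_mod_cast h)

theorem prod_primeFactors_le {T : ℕ} (hT : T ≠ 0) :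
    ∏ p ∈ T.primeFactors, (1 - 1 / (p : ℝ))⁻¹ ≤
      2 * Real.exp 10 * Real.log (Real.log (T + 16)) := by
  have hT0 : (0 : ℝ) < T := by exact_mod_cast Nat.pos_of_ne_zero hT
  set L : ℝ := Real.log (T + 16) with hL
  have hLL : 1 ≤ Real.log L := one_le_log_log (by linarith)
  have hL2 : 2 ≤ L := by
    have h1 : Real.log 16 ≤ L := Real.log_le_log (by norm_num) (by linarith)
    have h16 : Real.log 16 = 4 * Real.log 2 := by
      rw [show (16 : ℝ) = 2 ^ 4 by norm_num, Real.log_pow]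
      norm_num
    linarith [Real.log_two_gt_d9]
  have hn : 2 ≤ ⌊L⌋₊ := Nat.le_floor (by exact_mod_cast hL2)
  have htwo : ∀ p ∈ T.primeFactors, (2 : ℝ) ≤ p := fun p hp => by
    exact_mod_cast (Nat.prime_of_mem_primeFactors hp).two_le
  have hnonneg : ∀ p ∈ T.primeFactors, 0 ≤ (1 - 1 / (p : ℝ))⁻¹ := fun p hp =>
    zero_le_one.trans (one_le_one_sub_one_div_inv (htwo p hp))
  have hsmall : ∏ p ∈ T.primeFactors with p ≤ ⌊L⌋₊, (1 - 1 / (p : ℝ))⁻¹ ≤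
      Real.exp 6 * (2 * Real.log L) := by
    calc ∏ p ∈ T.primeFactors with p ≤ ⌊L⌋₊, (1 - 1 / (p : ℝ))⁻¹
        ≤ ∏ p ∈ (⌊L⌋₊).primesLE, (1 - 1 / (p : ℝ))⁻¹ := by
          refine Finset.prod_le_prod_of_subset_of_one_le ?_ ?_ ?_
          · intro p hp
            rw [Finset.mem_filter] at hp
            exact Nat.mem_primesLE.2 ⟨hp.2, Nat.prime_of_mem_primeFactors hp.1⟩
          · exact fun p hp => hnonneg p (Finset.mem_filter.1 hp).1
          · exact fun p hp _ => one_le_one_sub_one_div_inv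
              (by exact_mod_cast Nat.two_le_of_mem_primesLE hp)
      _ ≤ Real.exp 6 * (1 + Real.log ⌊L⌋₊) := prod_primesLE_le hn
      _ ≤ Real.exp 6 * (2 * Real.log L) := by
          have : Real.log ⌊L⌋₊ ≤ Real.log L :=
            Real.log_le_log (by exact_mod_cast (by omega : 0 < ⌊L⌋₊)) (Nat.floor_le (by linarith))
          gcongr
          linarith
  have hlarge : ∏ p ∈ T.primeFactors with ¬ p ≤ ⌊L⌋₊, (1 - 1 / (p : ℝ))⁻¹ ≤ Real.exp 4 := by
    calc ∏ p ∈ T.primeFactors with ¬ p ≤ ⌊L⌋₊, (1 - 1 / (p : ℝ))⁻¹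
        ≤ ∏ p ∈ T.primeFactors with ¬ p ≤ ⌊L⌋₊, Real.exp (2 / L) := by
          refine Finset.prod_le_prod
            (fun p hp => hnonneg p (Finset.mem_filter.1 hp).1) fun p hp => ?_
          rw [Finset.mem_filter, not_le] at hp
          refine (one_sub_one_div_inv_le_exp (htwo p hp.1)).trans ?_
          have : L ≤ p := (Nat.lt_of_floor_lt hp.2).le
          gcongr
      _ ≤ Real.exp (2 / L) ^ T.primeFactors.card := by
          rw [Finset.prod_const]
          exact pow_le_pow_right₀ (Real.one_le_exp (by positivity)) (Finset.card_filter_le _ _)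
      _ ≤ Real.exp 4 := by
          rw [← Real.exp_nat_mul]
          refine Real.exp_le_exp.2 ?_
          have h1 := card_primeFactors_mul_log_two_le hT
          have h2 : Real.log T ≤ L := Real.log_le_log hT0 (by linarith)
          rw [mul_div_assoc', div_le_iff₀ (by linarith)]
          nlinarith [Real.log_two_gt_d9, Nat.cast_nonneg (α := ℝ) T.primeFactors.card]
  rw [← Finset.prod_filter_mul_prod_filter_not T.primeFactors (fun p => p ≤ ⌊L⌋₊)]
  calc _ ≤ Real.exp 6 * (2 * Real.log L) * Real.exp 4 :=
        mul_le_mul hsmall hlarge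
          (Finset.prod_nonneg fun p hp => hnonneg p (Finset.mem_filter.1 hp).1) (by positivity)
    _ = 2 * (Real.exp 6 * Real.exp 4) * Real.log L := by ring
    _ = _ := by rw [← Real.exp_add]; norm_num

theorem rho4_le (a b : Fin 4 → ℤ) {ℓ : ℕ} (hℓ : ℓ ≠ 0) : rho4 a b ℓ ≤ ℓ := by
  have : NeZero ℓ := ⟨hℓ⟩
  calc rho4 a b ℓ ≤ (Set.univ : Set (ZMod ℓ)).ncard :=
        Set.ncard_le_ncard (Set.subset_univ _) (Set.toFinite _)
    _ = ℓ := by rw [Set.ncard_univ, Nat.card_zmod]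

theorem rho4_eq_ncard_range {a b : Fin 4 → ℤ} {ℓ : ℕ} [Fact ℓ.Prime]
    (ha : ∀ i, (a i : ZMod ℓ) ≠ 0) :
    rho4 a b ℓ = (Set.range fun i => -(b i : ZMod ℓ) / (a i : ZMod ℓ)).ncard := by
  unfold rho4
  congr 1
  ext n
  simp only [Set.mem_ofPred_eq, Finset.prod_eq_zero_iff, Finset.mem_univ, true_and, Set.mem_range]
  refine exists_congr fun i => ?_
  rw [div_eq_iff (ha i), mul_comm, add_eq_zero_iff_eq_neg, eq_comm]

theorem one_le_rho4 {a b : Fin 4 → ℤ} {ℓ : ℕ} [Fact ℓ.Prime]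
    (ha : ∀ i, (a i : ZMod ℓ) ≠ 0) : 1 ≤ rho4 a b ℓ := by
  rw [rho4_eq_ncard_range ha]
  exact (Set.ncard_pos (Set.toFinite _)).2 (Set.range_nonempty _)

theorem rho4_eq_four {a b : Fin 4 → ℤ} {ℓ : ℕ} [Fact ℓ.Prime]
    (ha : ∀ i, (a i : ZMod ℓ) ≠ 0) (hT : ¬ (ℓ : ℤ) ∣ resultantProd a b) : rho4 a b ℓ = 4 := by
  have hne : ∀ i j : Fin 4, i < j →
      -(b i : ZMod ℓ) / (a i : ZMod ℓ) ≠ -(b j : ZMod ℓ) / (a j : ZMod ℓ) := by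
    intro i j hij h
    rw [div_eq_div_iff (ha i) (ha j)] at h
    refine hT ((?_ : (ℓ : ℤ) ∣ a i * b j - a j * b i).trans
      (Finset.dvd_prod_of_mem (fun p : Fin 4 × Fin 4 => a p.1 * b p.2 - a p.2 * b p.1)
        (a := (i, j)) (by simpa using hij)))
    rw [← ZMod.intCast_zmod_eq_zero_iff_dvd]
    push_cast
    linear_combination h
  have hinj : Function.Injective fun i => -(b i : ZMod ℓ) / (a i : ZMod ℓ) := by
    intro i j h
    rcases lt_trichotomy i j with hij | hij | hij
    · exact absurd h (hne i j hij)
    · exact hij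
    · exact absurd h.symm (hne j i hij)
  rw [rho4_eq_ncard_range ha, ← Set.image_univ, Set.ncard_image_of_injective _ hinj,
    Set.ncard_univ, Nat.card_fin]

/-- The local factor of the singular series at `ℓ`. -/
noncomputable def localFactor (a b : Fin 4 → ℤ) (ℓ : ℕ) : ℝ :=
  (1 - (rho4 a b ℓ : ℝ) / (ℓ : ℝ)) * ((1 - 1 / (ℓ : ℝ))⁻¹) ^ 4

theorem localFactor_nonneg (a b : Fin 4 → ℤ) {ℓ : ℕ} (hℓ : ℓ ≠ 0) : 0 ≤ localFactor a b ℓ := by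
  have h1 : (rho4 a b ℓ : ℝ) / ℓ ≤ 1 :=
    div_le_one_of_le₀ (by exact_mod_cast rho4_le a b hℓ) (Nat.cast_nonneg _)
  exact mul_nonneg (by linarith) (by positivity)

theorem localFactor_le_sixteen (a b : Fin 4 → ℤ) {ℓ : ℕ} (hℓ : ℓ.Prime) :
    localFactor a b ℓ ≤ 16 := by
  have h2 : (2 : ℝ) ≤ ℓ := by exact_mod_cast hℓ.two_le
  have hx : 1 / (ℓ : ℝ) ≤ 1 / 2 := one_div_le_one_div_of_le two_pos h2
  have hinv : (1 - 1 / (ℓ : ℝ))⁻¹ ≤ 2 := inv_le_of_inv_le₀ two_pos (by norm_num at hx ⊢; linarith)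
  have hinv0 := zero_le_one.trans (one_le_one_sub_one_div_inv h2)
  have hρ : 0 ≤ (rho4 a b ℓ : ℝ) / ℓ := by positivity
  calc localFactor a b ℓ ≤ 1 * 2 ^ 4 := by
        unfold localFactor
        gcongr
        linarith
    _ = 16 := by norm_num

theorem localFactor_le_inv_pow {a b : Fin 4 → ℤ} {ℓ : ℕ} (hℓ : ℓ.Prime)
    (hρ : 1 ≤ rho4 a b ℓ) : localFactor a b ℓ ≤ ((1 - 1 / (ℓ : ℝ))⁻¹) ^ 3 := by
  have h2 : (2 : ℝ) ≤ ℓ := by exact_mod_cast hℓ.two_le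
  have hx : 1 / (ℓ : ℝ) ≤ 1 / 2 := one_div_le_one_div_of_le two_pos h2
  have hinv0 := zero_le_one.trans (one_le_one_sub_one_div_inv h2)
  have hρ' : 1 / (ℓ : ℝ) ≤ rho4 a b ℓ / ℓ := by
    gcongr
    exact_mod_cast hρ
  calc localFactor a b ℓ ≤ (1 - 1 / (ℓ : ℝ)) * ((1 - 1 / (ℓ : ℝ))⁻¹) ^ 4 := by
        unfold localFactor
        gcongr
    _ = ((1 - 1 / (ℓ : ℝ))⁻¹) ^ 3 := by
        rw [pow_succ' _ 3, mul_inv_cancel_left₀ (by linarith)]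

theorem localFactor_le_one_of_rho4_eq_four {a b : Fin 4 → ℤ} {ℓ : ℕ} (hℓ : ℓ.Prime)
    (hρ : rho4 a b ℓ = 4) : localFactor a b ℓ ≤ 1 := by
  have h2 : (2 : ℝ) ≤ ℓ := by exact_mod_cast hℓ.two_le
  have hx : 1 / (ℓ : ℝ) ≤ 1 / 2 := one_div_le_one_div_of_le two_pos h2
  have hx0 : 0 < 1 / (ℓ : ℝ) := by positivity
  have hB := one_add_mul_le_pow (a := -(1 / (ℓ : ℝ))) (by linarith) 4
  have hpos : 0 < 1 - 1 / (ℓ : ℝ) := by linarith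
  unfold localFactor
  rw [hρ, inv_pow, ← div_eq_mul_inv, div_le_one (by positivity)]
  calc 1 - ((4 : ℕ) : ℝ) / ℓ = 1 + ((4 : ℕ) : ℝ) * -(1 / (ℓ : ℝ)) := by ring
    _ ≤ _ := hB
    _ = _ := by ring

theorem abs_localFactor_sub_one_le {a b : Fin 4 → ℤ} {ℓ : ℕ} (hℓ : ℓ.Prime)
    (hρ : rho4 a b ℓ = 4) : ‖localFactor a b ℓ - 1‖ ≤ 112 * (1 / (ℓ : ℝ) ^ 2) := by
  have h2 : (2 : ℝ) ≤ ℓ := by exact_mod_cast hℓ.two_le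
  have hx : 1 / (ℓ : ℝ) ≤ 1 / 2 := one_div_le_one_div_of_le two_pos h2
  have hx0 : 0 < 1 / (ℓ : ℝ) := by positivity
  rw [Real.norm_of_nonpos (by linarith [localFactor_le_one_of_rho4_eq_four hℓ hρ])]
  have hinv : (1 - 1 / (ℓ : ℝ))⁻¹ ≤ 2 := inv_le_of_inv_le₀ two_pos (by norm_num at hx ⊢; linarith)
  have hinv0 := zero_le_one.trans (one_le_one_sub_one_div_inv h2)
  have hsq : (1 : ℝ) / (ℓ : ℝ) ^ 2 = (1 / (ℓ : ℝ)) ^ 2 := by rw [one_div_pow]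
  have hfac : localFactor a b ℓ = (1 - 4 * (1 / (ℓ : ℝ))) * ((1 - 1 / (ℓ : ℝ))⁻¹) ^ 4 := by
    rw [localFactor, hρ]
    push_cast
    ring
  rw [hsq, hfac]
  generalize 1 / (ℓ : ℝ) = x at hx hx0 hinv hinv0 ⊢
  have hne : (1 - x) * (1 - x)⁻¹ = 1 := mul_inv_cancel₀ (by linarith)
  generalize (1 - x)⁻¹ = y at hinv hinv0 hne ⊢
  have h4 : (1 - x) ^ 4 * y ^ 4 = 1 := by rw [← mul_pow, hne, one_pow]
  calc -((1 - 4 * x) * y ^ 4 - 1) = (6 * x ^ 2 - 4 * x ^ 3 + x ^ 4) * y ^ 4 := by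
        linear_combination -h4
    _ ≤ (7 * x ^ 2) * 2 ^ 4 := by
        have hle : 6 * x ^ 2 - 4 * x ^ 3 + x ^ 4 ≤ 7 * x ^ 2 := by
          nlinarith [pow_pos hx0 2, pow_pos hx0 3]
        gcongr
    _ = 112 * x ^ 2 := by ring

theorem localFactor_le {a b : Fin 4 → ℤ} {ℓ : ℕ} (hℓ : ℓ.Prime)
    (ha : 3 < ℓ → ∀ i, (a i : ZMod ℓ) ≠ 0) :
    localFactor a b ℓ ≤ (if ℓ ≤ 3 then 16 else 1) *
      (if ℓ ∣ (resultantProd a b).natAbs then (1 - 1 / (ℓ : ℝ))⁻¹ else 1) ^ 3 := by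
  have : Fact ℓ.Prime := ⟨hℓ⟩
  have hone := one_le_one_sub_one_div_inv (x := ℓ) (by exact_mod_cast hℓ.two_le)
  by_cases h3 : ℓ ≤ 3
  · rw [if_pos h3]
    have h1 : 1 ≤ (if ℓ ∣ (resultantProd a b).natAbs then (1 - 1 / (ℓ : ℝ))⁻¹ else 1) := by
      split_ifs
      exacts [hone, le_rfl]
    nlinarith [one_le_pow₀ h1 (n := 3), localFactor_le_sixteen a b hℓ]
  · rw [if_neg h3, one_mul]
    specialize ha (not_le.1 h3)
    split_ifs with hd
    · exact localFactor_le_inv_pow hℓ (one_le_rho4 ha)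
    · rw [one_pow]
      refine localFactor_le_one_of_rho4_eq_four hℓ (rho4_eq_four ha ?_)
      rwa [Int.natCast_dvd]

theorem multipliable_localFactor {a b : Fin 4 → ℤ} (hT : resultantProd a b ≠ 0)
    (ha : ∀ ℓ : ℕ, ℓ.Prime → 3 < ℓ → ∀ i, (a i : ZMod ℓ) ≠ 0) :
    Multipliable fun ℓ : {ℓ : ℕ // ℓ.Prime} => localFactor a b ℓ.1 := by
  have hsum : Summable fun ℓ : {ℓ : ℕ // ℓ.Prime} => localFactor a b ℓ.1 - 1 := by
    have hg : Summable fun ℓ : {ℓ : ℕ // ℓ.Prime} => 112 * (1 / ((ℓ.1 : ℕ) : ℝ) ^ 2) :=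
      ((Real.summable_one_div_nat_pow.2 one_lt_two).mul_left 112).comp_injective
        Subtype.val_injective
    refine Summable.of_norm_bounded_eventually hg ?_
    have hfin : ((fun ℓ : {ℓ : ℕ // ℓ.Prime} => ℓ.1) ⁻¹'
        (Set.Iic (3 + (resultantProd a b).natAbs))).Finite :=
      (Set.finite_Iic _).preimage Subtype.val_injective.injOn
    filter_upwards [hfin.compl_mem_cofinite] with ℓ hℓ
    simp only [Set.mem_compl_iff, Set.mem_preimage, Set.mem_Iic, not_le] at hℓ
    have : Fact ℓ.1.Prime := ⟨ℓ.2⟩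
    refine abs_localFactor_sub_one_le ℓ.2 (rho4_eq_four (ha ℓ.1 ℓ.2 (by omega)) ?_)
    rw [Int.natCast_dvd]
    intro hd
    have := Nat.le_of_dvd (Int.natAbs_pos.2 hT) hd
    omega
  simpa using Real.multipliable_one_add_of_summable hsum

theorem prod_localFactor_le {a b : Fin 4 → ℤ} (hT : resultantProd a b ≠ 0)
    (ha : ∀ ℓ : ℕ, ℓ.Prime → 3 < ℓ → ∀ i, (a i : ZMod ℓ) ≠ 0)
    {s : Finset ℕ} (hs : ∀ ℓ ∈ s, ℓ.Prime) :
    ∏ ℓ ∈ s, localFactor a b ℓ ≤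
      16 ^ 2 * (∏ p ∈ (resultantProd a b).natAbs.primeFactors, (1 - 1 / (p : ℝ))⁻¹) ^ 3 := by
  have hsmall : ∏ ℓ ∈ s, (if ℓ ≤ 3 then (16 : ℝ) else 1) ≤ 16 ^ 2 := by
    rw [← Finset.prod_filter, Finset.prod_const]
    have hsub : s.filter (· ≤ 3) ⊆ {2, 3} := by
      intro ℓ hℓ
      rw [Finset.mem_filter] at hℓ
      have := (hs ℓ hℓ.1).two_le
      simp only [Finset.mem_insert, Finset.mem_singleton]
      omega
    exact pow_le_pow_right₀ (by norm_num) (Finset.card_le_card hsub)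
  have hdvd : ∏ ℓ ∈ s, (if ℓ ∣ (resultantProd a b).natAbs then (1 - 1 / (ℓ : ℝ))⁻¹ else 1) ≤
      ∏ p ∈ (resultantProd a b).natAbs.primeFactors, (1 - 1 / (p : ℝ))⁻¹ := by
    rw [← Finset.prod_filter]
    refine Finset.prod_le_prod_of_subset_of_one_le ?_ ?_ ?_
    · intro ℓ hℓ
      rw [Finset.mem_filter] at hℓ
      exact Nat.mem_primeFactors.2 ⟨hs ℓ hℓ.1, hℓ.2, Int.natAbs_ne_zero.2 hT⟩
    · intro ℓ hℓ
      exact zero_le_one.trans (one_le_one_sub_one_div_inv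
        (by exact_mod_cast (hs ℓ (Finset.mem_filter.1 hℓ).1).two_le))
    · intro p hp _
      exact one_le_one_sub_one_div_inv
        (by exact_mod_cast (Nat.prime_of_mem_primeFactors hp).two_le)
  have hnonneg : 0 ≤
      ∏ ℓ ∈ s, (if ℓ ∣ (resultantProd a b).natAbs then (1 - 1 / (ℓ : ℝ))⁻¹ else 1) := by
    refine Finset.prod_nonneg fun ℓ hℓ => ?_
    split_ifs
    · exact zero_le_one.trans (one_le_one_sub_one_div_inv
        (by exact_mod_cast (hs ℓ hℓ).two_le))
    · exact zero_le_one
  calc ∏ ℓ ∈ s, localFactor a b ℓ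
      ≤ ∏ ℓ ∈ s, ((if ℓ ≤ 3 then 16 else 1) *
          (if ℓ ∣ (resultantProd a b).natAbs then (1 - 1 / (ℓ : ℝ))⁻¹ else 1) ^ 3) :=
        Finset.prod_le_prod (fun ℓ hℓ => localFactor_nonneg a b (hs ℓ hℓ).ne_zero)
          fun ℓ hℓ => localFactor_le (hs ℓ hℓ) (ha ℓ (hs ℓ hℓ))
    _ ≤ _ := by
        rw [Finset.prod_mul_distrib, Finset.prod_pow]
        gcongr

theorem singular_series_bound :
    ∃ c : ℝ, 0 < c ∧
      ∀ a b : Fin 4 → ℤ,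
        (∀ i, 0 < a i) →
        (∀ i, ∀ ℓ : ℕ, ℓ.Prime → (ℓ : ℤ) ∣ a i → ℓ = 2 ∨ ℓ = 3) →
        (∀ i, IsCoprime (a i) (b i)) →
        resultantProd a b ≠ 0 →
        rho4 a b 2 ≤ 1 → rho4 a b 3 ≤ 1 →
        Multipliable (fun ℓ : {ℓ : ℕ // ℓ.Prime} =>
          (1 - (rho4 a b ℓ.1 : ℝ) / (ℓ.1 : ℝ)) * ((1 - 1 / (ℓ.1 : ℝ))⁻¹) ^ 4) ∧
        (∏' ℓ : {ℓ : ℕ // ℓ.Prime},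
            (1 - (rho4 a b ℓ.1 : ℝ) / (ℓ.1 : ℝ)) * ((1 - 1 / (ℓ.1 : ℝ))⁻¹) ^ 4) ≤
          c * (Real.log (Real.log ((|resultantProd a b| : ℤ) + 16))) ^ 3 := by
  refine ⟨16 ^ 2 * (2 * Real.exp 10) ^ 3, by positivity, ?_⟩
  intro a b _ hprime _ hT _ _
  have ha : ∀ ℓ : ℕ, ℓ.Prime → 3 < ℓ → ∀ i, (a i : ZMod ℓ) ≠ 0 := by
    intro ℓ hℓ h3 i h
    have := hprime i ℓ hℓ ((ZMod.intCast_zmod_eq_zero_iff_dvd _ _).1 h)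
    omega
  have hmul := multipliable_localFactor hT ha
  refine ⟨hmul, le_of_tendsto hmul.hasProd (Filter.Eventually.of_forall fun s => ?_)⟩
  have hs := prod_localFactor_le hT ha (s := s.map (Function.Embedding.subtype _)) (by
    intro ℓ hℓ
    obtain ⟨q, -, rfl⟩ := Finset.mem_map.1 hℓ
    exact q.2)
  rw [Finset.prod_map] at hs
  refine hs.trans ?_
  have hcast : ((|resultantProd a b| : ℤ) : ℝ) = ((resultantProd a b).natAbs : ℝ) := by
    rw [Nat.cast_natAbs]
  rw [hcast, mul_assoc, ← mul_pow]
  have h0 : 0 ≤ ∏ p ∈ (resultantProd a b).natAbs.primeFactors, (1 - 1 / (p : ℝ))⁻¹ :=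
    Finset.prod_nonneg fun p hp => zero_le_one.trans (one_le_one_sub_one_div_inv
      (by exact_mod_cast (Nat.prime_of_mem_primeFactors hp).two_le))
  have hle := prod_primeFactors_le (Int.natAbs_ne_zero.2 hT)
  gcongr
end
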